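/- Every connected C-homogeneous digraph of Type II with more than one end is highly-arc-transitive. -/

import Mathlib

open Set

universe u

/-- The underlying undirected graph of a digraph given by its edge relation. -/
def UG {V : Type u} (E : V → V → Prop) : SimpleGraph V := SimpleGraph.fromRel E

/-- `E` is a digraph edge relation: irreflexive and antisymmetric. -/
def IsDigraph {V : Type u} (E : V → V → Prop) : Prop :=
  (∀ x, ¬ E x x) ∧ ∀ x y, E x y → ¬ E y x

/-- A ray in a graph: a one-way infinite path. -/
def IsRay {V : Type u} (G : SimpleGraph V) (r : ℕ → V) : Prop :=
  Function.Injective r ∧ ∀ n, G.Adj (r n) (r (n + 1))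

/-- A sequence is eventually in a set. -/
def EventuallyIn {V : Type u} (r : ℕ → V) (C : Set V) : Prop :=
  ∃ N, ∀ n, N ≤ n → r n ∈ C

/-- `C` is a connected component of the subgraph of `G` induced on `W`:
a maximal connected subset of `W`. -/
def IsCompOf {V : Type u} (G : SimpleGraph V) (C W : Set V) : Prop :=
  C.Nonempty ∧ C ⊆ W ∧ (G.induce C).Connected ∧
    ∀ C', C ⊆ C' → C' ⊆ W → (G.induce C').Connected → C' = C

/-- Two rays are equivalent if for every finite vertex set `S` they lie eventually
in the same component of the graph minus `S`. -/
def RayEquiv {V : Type u} (G : SimpleGraph V) (r r' : ℕ → V) : Prop :=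
  ∀ S : Finset V, ∃ C : Set V, IsCompOf G C {v | v ∉ S} ∧
    EventuallyIn r C ∧ EventuallyIn r' C

/-- The graph has more than one end: two inequivalent rays. -/
def MoreThanOneEnd {V : Type u} (G : SimpleGraph V) : Prop :=
  ∃ r r' : ℕ → V, IsRay G r ∧ IsRay G r' ∧ ¬ RayEquiv G r r'

/-- The graph has infinitely many ends: arbitrarily large families of pairwise
inequivalent rays. -/
def InfinitelyManyEnds {V : Type u} (G : SimpleGraph V) : Prop :=
  ∀ n : ℕ, ∃ f : Fin n → (ℕ → V), (∀ i, IsRay G (f i)) ∧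
    ∀ i j, i ≠ j → ¬ RayEquiv G (f i) (f j)

/-- A separation of a graph: a pair of vertex sets covering `V` such that every
edge lies within one side. -/
def IsSeparation {V : Type u} (G : SimpleGraph V) (c : Set V × Set V) : Prop :=
  c.1 ∪ c.2 = univ ∧ ∀ x y, G.Adj x y → (x ∈ c.1 ∧ y ∈ c.1) ∨ (x ∈ c.2 ∧ y ∈ c.2)

/-- The order of a separation: the number of vertices in its separator. -/
noncomputable def sepOrder {V : Type u} (c : Set V × Set V) : ℕ := (c.1 ∩ c.2).ncard

/-- The neighbourhood of a vertex set. -/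
def Nbhd {V : Type u} (G : SimpleGraph V) (A : Set V) : Set V :=
  {v | v ∉ A ∧ ∃ u ∈ A, G.Adj u v}

/-- The separation `(A, ∼)`. -/
def tildeSep {V : Type u} (G : SimpleGraph V) (A : Set V) : Set V × Set V :=
  (A, Aᶜ ∪ Nbhd G Aᶜ)

/-- `S` separates the wings of the separation `c`: every walk from one wing to
the other meets `S`. -/
def SeparatesWings {V : Type u} (G : SimpleGraph V) (c : Set V × Set V) (S : Set V) : Prop :=
  ∀ a ∈ c.1 \ c.2, ∀ b ∈ c.2 \ c.1, ∀ w : G.Walk a b, ∃ v ∈ w.support, v ∈ S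

/-- A separation of finite order with non-empty wings is essential if its first wing is
connected and no proper subset of the separator separates the wings. -/
def IsEssential {V : Type u} (G : SimpleGraph V) (c : Set V × Set V) : Prop :=
  IsSeparation G c ∧ (c.1 ∩ c.2).Finite ∧ (c.1 \ c.2).Nonempty ∧ (c.2 \ c.1).Nonempty ∧
  (G.induce (c.1 \ c.2)).Connected ∧
  ∀ S, S ⊂ c.1 ∩ c.2 → ¬ SeparatesWings G c S

/-- `C` is a wing of some separation in `𝒞`. -/
def IsWingOf {V : Type u} (𝒞 : Set (Set V × Set V)) (C : Set V) : Prop :=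
  ∃ d ∈ 𝒞, C = d.1 \ d.2 ∨ C = d.2 \ d.1

/-- A cut system. -/
def IsCutSystem {V : Type u} (G : SimpleGraph V) (𝒞 : Set (Set V × Set V)) : Prop :=
  𝒞.Nonempty ∧ (∀ c ∈ 𝒞, IsEssential G c) ∧
  (∀ c ∈ 𝒞, ∃ d ∈ 𝒞, d.1 ⊆ c.2) ∧
  (∀ c ∈ 𝒞, ∀ C : Set V, IsCompOf G C (c.2 \ c.1) →
    (∃ d ∈ 𝒞, d.1 \ d.2 ⊆ C) → tildeSep G (C ∪ Nbhd G C) ∈ 𝒞) ∧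
  (∀ c ∈ 𝒞, ∀ c' ∈ 𝒞, ∃ C₁ C₂ : Set V,
    ((IsCompOf G C₁ ((c.1 \ c.2) ∩ (c'.1 \ c'.2)) ∧
      IsCompOf G C₂ ((c.2 \ c.1) ∩ (c'.2 \ c'.1))) ∨
     (IsCompOf G C₁ ((c.2 \ c.1) ∩ (c'.1 \ c'.2)) ∧
      IsCompOf G C₂ ((c.1 \ c.2) ∩ (c'.2 \ c'.1)))) ∧
    IsWingOf 𝒞 C₁ ∧ IsWingOf 𝒞 C₂)

/-- Pick a side of a separation. -/
def pickSide {V : Type u} (c : Set V × Set V) : Bool → Set V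
  | false => c.1
  | true => c.2

/-- Two cuts are nested (with respect to the cut system `𝒞`). -/
def NestedPair {V : Type u} (G : SimpleGraph V) (𝒞 : Set (Set V × Set V))
    (c d : Set V × Set V) : Prop :=
  ∃ i j : Bool,
    ((¬ ∃ C, IsCompOf G C ((tildeSep G (pickSide c i ∩ pickSide d j)).1 \
        (tildeSep G (pickSide c i ∩ pickSide d j)).2) ∧
        tildeSep G (C ∪ Nbhd G C) ∈ 𝒞) ∨
     (¬ ∃ C, IsCompOf G C ((tildeSep G (pickSide c i ∩ pickSide d j)).2 \
        (tildeSep G (pickSide c i ∩ pickSide d j)).1) ∧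
        tildeSep G (C ∪ Nbhd G C) ∈ 𝒞)) ∧
    (c.1 ∩ c.2) ∪ (d.1 ∩ d.2) ⊆ pickSide c (!i) ∩ pickSide d (!j)

/-- A cut system is nested if each two of its cuts are nested. -/
def IsNestedSystem {V : Type u} (G : SimpleGraph V) (𝒞 : Set (Set V × Set V)) : Prop :=
  ∀ c ∈ 𝒞, ∀ d ∈ 𝒞, NestedPair G 𝒞 c d

/-- `S` is a `𝒞`-separator. -/
def IsSeparatorOf {V : Type u} (𝒞 : Set (Set V × Set V)) (S : Set V) : Prop :=
  ∃ c ∈ 𝒞, c.1 ∩ c.2 = S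

/-- A vertex set contains an end: some ray lies in it. -/
def ContainsEnd {V : Type u} (G : SimpleGraph V) (A : Set V) : Prop :=
  ∃ r : ℕ → V, IsRay G r ∧ ∀ n, r n ∈ A

/-- A basic cut system. -/
def IsBasic {V : Type u} (G : SimpleGraph V) (𝒞 : Set (Set V × Set V)) : Prop :=
  IsCutSystem G 𝒞 ∧
  (∀ c ∈ 𝒞, ∀ d ∈ 𝒞, ¬ sepOrder c < sepOrder d) ∧
  IsNestedSystem G 𝒞 ∧
  (∀ φ : G ≃g G, ∀ c ∈ 𝒞, ((⇑φ '' c.1, ⇑φ '' c.2) : Set V × Set V) ∈ 𝒞) ∧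
  (∀ S S' : Set V, IsSeparatorOf 𝒞 S → IsSeparatorOf 𝒞 S' → ∃ φ : G ≃g G, ⇑φ '' S = S') ∧
  (∀ c ∈ 𝒞, ContainsEnd G c.1 ∧ ContainsEnd G c.2 ∧
    ¬ ∃ d : Set V × Set V, IsSeparation G d ∧ (d.1 ∩ d.2).Finite ∧
      (d.1 ∩ d.2).ncard < sepOrder c ∧ ContainsEnd G d.1 ∧ ContainsEnd G d.2)

/-- The defining property of a `𝒞`-block. -/
def BlockProp {V : Type u} (𝒞 : Set (Set V × Set V)) (X : Set V) : Prop :=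
  (∀ c ∈ 𝒞, (X ⊆ c.1 ∨ X ⊆ c.2) ∧ ¬ (X ⊆ c.1 ∧ X ⊆ c.2)) ∧
  ∃ c ∈ 𝒞, X ⊆ c.1 ∧ c.1 ∩ c.2 ⊆ X

/-- A `𝒞`-block: a maximal vertex set with the block property. -/
def IsCBlock {V : Type u} (𝒞 : Set (Set V × Set V)) (X : Set V) : Prop :=
  BlockProp 𝒞 X ∧ ∀ X', X ⊆ X' → BlockProp 𝒞 X' → X' = X

/-- A digraph is C-homogeneous: every isomorphism between finite induced
subdigraphs with connected underlying graphs extends to an automorphism. -/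
def DigraphCHom {V : Type u} (E : V → V → Prop) : Prop :=
  ∀ (X Y : Set V), X.Finite → Y.Finite → ((UG E).induce X).Connected →
  ∀ φ : X ≃ Y, (∀ a b : X, E a.1 b.1 ↔ E (φ a).1 (φ b).1) →
  ∃ ψ : Equiv.Perm V, (∀ x y, E (ψ x) (ψ y) ↔ E x y) ∧ ∀ a : X, ψ a.1 = (φ a).1

/-- A graph is C-homogeneous: every isomorphism between finite connected induced
subgraphs extends to an automorphism. -/
def GraphCHom {V : Type u} (G : SimpleGraph V) : Prop :=
  ∀ (X Y : Set V), X.Finite → Y.Finite → (G.induce X).Connected →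
  ∀ φ : X ≃ Y, (∀ a b : X, G.Adj a.1 b.1 ↔ G.Adj (φ a).1 (φ b).1) →
  ∃ ψ : G ≃g G, ∀ a : X, ψ a.1 = (φ a).1

/-- The digraph contains a triangle: three pairwise adjacent vertices. -/
def HasTriangle {V : Type u} (E : V → V → Prop) : Prop :=
  ∃ x y z : V, (UG E).Adj x y ∧ (UG E).Adj y z ∧ (UG E).Adj x z

/-- An `n`-arc: a directed path `p 0, p 1, …, p n`. -/
def IsArc {V : Type u} (E : V → V → Prop) (n : ℕ) (p : ℕ → V) : Prop :=
  (∀ i j, i ≤ n → j ≤ n → p i = p j → i = j) ∧ ∀ i < n, E (p i) (p (i + 1))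

/-- A digraph is highly-arc-transitive: for every `n`, its automorphism group acts
transitively on `n`-arcs. -/
def HighlyArcTransitive {V : Type u} (E : V → V → Prop) : Prop :=
  ∀ n : ℕ, ∀ p q : ℕ → V, IsArc E n p → IsArc E n q →
  ∃ ψ : Equiv.Perm V, (∀ x y, E (ψ x) (ψ y) ↔ E x y) ∧ ∀ i ≤ n, ψ (p i) = q i

/-- An alternating walk `w 0, …, w n` in a digraph. -/
def IsAltWalk {V : Type u} (E : V → V → Prop) (n : ℕ) (w : ℕ → V) : Prop :=
  (∀ i < n, E (w i) (w (i + 1)) ∨ E (w (i + 1)) (w i)) ∧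
  ∀ i, i + 2 ≤ n → (E (w i) (w (i + 1)) ↔ E (w (i + 2)) (w (i + 1)))

/-- The edge `e` lies on the walk `w 0, …, w n` (in either direction). -/
def EdgeOnWalk {V : Type u} (n : ℕ) (w : ℕ → V) (e : V × V) : Prop :=
  ∃ i < n, (w i = e.1 ∧ w (i + 1) = e.2) ∨ (w i = e.2 ∧ w (i + 1) = e.1)

/-- Two edges are reachable from each other: they lie on a common alternating walk. -/
def Reach {V : Type u} (E : V → V → Prop) (e f : V × V) : Prop :=
  ∃ n w, IsAltWalk E n w ∧ EdgeOnWalk n w e ∧ EdgeOnWalk n w f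

/-- The edge relation of the reachability digraph `Δ_e`. -/
def DeltaRel {V : Type u} (E : V → V → Prop) (e : V × V) : V → V → Prop :=
  fun x y => E x y ∧ Reach E e (x, y)

/-- The underlying undirected graph of the reachability digraph `Δ_e`. -/
def DeltaGraph {V : Type u} (E : V → V → Prop) (e : V × V) : SimpleGraph V :=
  UG (DeltaRel E e)

/-- Tails of edges of `𝒜(e)`. -/
def Tails {V : Type u} (E : V → V → Prop) (e : V × V) : Set V :=
  {x | ∃ y, DeltaRel E e x y}

/-- Heads of edges of `𝒜(e)`. -/
def Heads {V : Type u} (E : V → V → Prop) (e : V × V) : Set V :=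
  {y | ∃ x, DeltaRel E e x y}

/-- The set of descendants of a vertex. -/
def Descendants {V : Type u} (E : V → V → Prop) (x : V) : Set V :=
  {y | ∃ n p, IsArc E n p ∧ p 0 = x ∧ p n = y}

/-- `(X, Y)` is a bipartition of the graph `G`. -/
def IsBipartition {V : Type u} (G : SimpleGraph V) (X Y : Set V) : Prop :=
  X ∪ Y = univ ∧ Disjoint X Y ∧
  ∀ a b, G.Adj a b → (a ∈ X ∧ b ∈ Y) ∨ (a ∈ Y ∧ b ∈ X)

/-- `G` with sides `X`, `Y` is C-homogeneous bipartite: every isomorphism between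
finite connected induced subgraphs preserving the sides extends to a side-preserving
automorphism. -/
def BipCHom {V : Type u} (G : SimpleGraph V) (X Y : Set V) : Prop :=
  ∀ (A B : Set V), A.Finite → B.Finite → (G.induce A).Connected →
  ∀ φ : A ≃ B, (∀ a b : A, G.Adj a.1 b.1 ↔ G.Adj (φ a).1 (φ b).1) →
  (∀ a : A, a.1 ∈ X ↔ (φ a).1 ∈ X) → (∀ a : A, a.1 ∈ Y ↔ (φ a).1 ∈ Y) →
  ∃ ψ : G ≃g G, (∀ v, v ∈ X ↔ ψ v ∈ X) ∧ (∀ v, v ∈ Y ↔ ψ v ∈ Y) ∧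
    ∀ a : A, ψ a.1 = (φ a).1

/-- `G` with sides `X`, `Y` is homogeneous bipartite: every isomorphism between
finite induced subgraphs preserving the sides extends to a side-preserving
automorphism. -/
def BipHom {V : Type u} (G : SimpleGraph V) (X Y : Set V) : Prop :=
  ∀ (A B : Set V), A.Finite → B.Finite →
  ∀ φ : A ≃ B, (∀ a b : A, G.Adj a.1 b.1 ↔ G.Adj (φ a).1 (φ b).1) →
  (∀ a : A, a.1 ∈ X ↔ (φ a).1 ∈ X) → (∀ a : A, a.1 ∈ Y ↔ (φ a).1 ∈ Y) →
  ∃ ψ : G ≃g G, (∀ v, v ∈ X ↔ ψ v ∈ X) ∧ (∀ v, v ∈ Y ↔ ψ v ∈ Y) ∧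
    ∀ a : A, ψ a.1 = (φ a).1

/-- `G` with sides `X`, `Y` is generic bipartite. -/
def GenericBip {V : Type u} (G : SimpleGraph V) (X Y : Set V) : Prop :=
  (∀ U W : Set V, U ⊆ X → W ⊆ X → U.Finite → W.Finite → Disjoint U W →
    ∃ v ∈ Y, (∀ u ∈ U, G.Adj v u) ∧ ∀ w ∈ W, ¬ G.Adj v w) ∧
  (∀ U W : Set V, U ⊆ Y → W ⊆ Y → U.Finite → W.Finite → Disjoint U W →
    ∃ v ∈ X, (∀ u ∈ U, G.Adj v u) ∧ ∀ w ∈ W, ¬ G.Adj v w)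

/-- `v` can be reached from `u` by a walk all of whose vertices after `u` lie in `X`. -/
def ReachIn {V : Type u} (G : SimpleGraph V) (X : Set V) (u v : V) : Prop :=
  Relation.ReflTransGen (fun a b => G.Adj a b ∧ b ∈ X) u v

/-- A nonempty vertex set that induces a connected subgraph. -/
def ConnSet {V : Type u} (G : SimpleGraph V) (X : Set V) : Prop :=
  ∃ o ∈ X, ∀ x ∈ X, ReachIn G X o x

/-- `u` and `v` lie in the same component of `G` minus `S`. -/
def ConnOff {V : Type u} (G : SimpleGraph V) (S : Set V) (u v : V) : Prop :=
  u ∉ S ∧ ReachIn G Sᶜ u v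

/-- Automorphisms of the relation `E`. -/
def IsAut {V : Type u} (E : V → V → Prop) (ψ : Equiv.Perm V) : Prop :=
  ∀ x y, E (ψ x) (ψ y) ↔ E x y

section Reach

variable {V : Type u} {G : SimpleGraph V} {X Y S : Set V} {u v w : V}

theorem ReachIn.refl (u : V) : ReachIn G X u u := Relation.ReflTransGen.refl

theorem ReachIn.trans (h : ReachIn G X u v) (h' : ReachIn G X v w) : ReachIn G X u w :=
  Relation.ReflTransGen.trans h h'

theorem ReachIn.step (h : ReachIn G X u v) (ha : G.Adj v w) (hw : w ∈ X) : ReachIn G X u w :=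
  Relation.ReflTransGen.tail h ⟨ha, hw⟩

theorem ReachIn.of_adj (ha : G.Adj v w) (hw : w ∈ X) : ReachIn G X v w :=
  Relation.ReflTransGen.single ⟨ha, hw⟩

theorem ReachIn.mono (hXY : X ⊆ Y) (h : ReachIn G X u v) : ReachIn G Y u v :=
  Relation.ReflTransGen.mono (fun _ _ h => ⟨h.1, hXY h.2⟩) _ _ h

theorem ReachIn.mem (h : ReachIn G X u v) (hu : u ∈ X) : v ∈ X := by
  cases h with
  | refl => exact hu
  | tail _ h => exact h.2

theorem ReachIn.symm (h : ReachIn G X u v) (hu : u ∈ X) : ReachIn G X v u := by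
  induction h with
  | refl => exact .refl _
  | tail h1 h2 ih => exact (ReachIn.of_adj h2.1.symm (ReachIn.mem h1 hu)).trans ih

theorem ReachIn.induction_mem {P : V → Prop} (h : ReachIn G X u v) (h0 : P u)
    (hs : ∀ a b, P a → G.Adj a b → b ∈ X → P b) : P v := by
  induction h with
  | refl => exact h0
  | tail h1 h2 ih => exact hs _ _ ih h2.1 h2.2

theorem ConnSet.reach (h : ConnSet G X) (hu : u ∈ X) (hv : v ∈ X) : ReachIn G X u v := by
  obtain ⟨o, ho, h⟩ := h
  exact ((h u hu).symm ho).trans (h v hv)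

theorem ConnSet.nonempty (h : ConnSet G X) : X.Nonempty := ⟨h.choose, h.choose_spec.1⟩

theorem ConnSet.induce (h : ConnSet G X) : (G.induce X).Connected := by
  obtain ⟨o, ho, h⟩ := h
  have key : ∀ x (hx : ReachIn G X o x), (G.induce X).Reachable ⟨o, ho⟩ ⟨x, hx.mem ho⟩ := by
    intro x hx
    induction hx with
    | refl => exact SimpleGraph.Reachable.refl _
    | tail h1 h2 ih =>
      exact ih.trans (SimpleGraph.Adj.reachable (by simpa using h2.1))
  have : Nonempty X := ⟨⟨o, ho⟩⟩
  refine SimpleGraph.Connected.mk ?_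
  intro a b
  exact (key a (h _ a.2)).symm.trans (key b (h _ b.2))

theorem ConnSet.of_induce (h : (G.induce X).Connected) : ConnSet G X := by
  obtain ⟨o⟩ := h.nonempty
  refine ⟨o, o.2, fun x hx => ?_⟩
  have := h.preconnected o ⟨x, hx⟩
  rw [SimpleGraph.reachable_iff_reflTransGen] at this
  have h2 : ∀ y : X, Relation.ReflTransGen (G.induce X).Adj o y → ReachIn G X o y := by
    intro y hy
    induction hy with
    | refl => exact .refl _
    | tail _ h2 ih => exact ih.step (by simpa using h2) (Subtype.mem _)
  exact h2 _ this

theorem ConnSet.singleton (u : V) : ConnSet G {u} :=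
  ⟨u, rfl, fun x hx => by rw [Set.mem_singleton_iff.1 hx]; exact .refl _⟩

/-- Enlarging a connected set by vertices at distance at most two through the new set. -/
theorem ConnSet.attach {M : Set V} (hM : ConnSet G M) (hMX : M ⊆ X)
    (h : ∀ x ∈ X, x ∈ M ∨ (∃ m ∈ M, G.Adj m x) ∨ ∃ y ∈ X, G.Adj y x ∧ ∃ m ∈ M, G.Adj m y) :
    ConnSet G X := by
  obtain ⟨o, ho, hM⟩ := hM
  refine ⟨o, hMX ho, fun x hx => ?_⟩
  rcases h x hx with h | ⟨m, hm, h⟩ | ⟨y, hy, h, m, hm, h'⟩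
  · exact (hM x h).mono hMX
  · exact ((hM m hm).mono hMX).step h hx
  · exact (((hM m hm).mono hMX).step h' hy).step h hx

theorem ConnSet.insert_adj (hX : ConnSet G X) (hu : u ∈ X) (h : G.Adj u v) :
    ConnSet G (insert v X) := by
  refine hX.attach (subset_insert _ _) ?_
  rintro x (rfl | hx)
  · exact Or.inr (Or.inl ⟨u, hu, h⟩)
  · exact Or.inl hx

theorem ConnSet.of_path (p : ℕ → V) (m : ℕ) (hp : ∀ i < m, G.Adj (p i) (p (i + 1))) :
    ConnSet G {x | ∃ i ≤ m, p i = x} := by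
  refine ⟨p 0, ⟨0, Nat.zero_le _, rfl⟩, ?_⟩
  rintro x ⟨i, hi, rfl⟩
  induction i with
  | zero => exact .refl _
  | succ i ih => exact (ih (by omega)).step (hp i (by omega)) ⟨i + 1, hi, rfl⟩

theorem ConnOff.refl (h : u ∉ S) : ConnOff G S u u := ⟨h, .refl _⟩

theorem ConnOff.right (h : ConnOff G S u v) : v ∉ S := h.2.mem h.1

theorem ConnOff.symm (h : ConnOff G S u v) : ConnOff G S v u := ⟨h.right, h.2.symm h.1⟩

theorem ConnOff.trans (h : ConnOff G S u v) (h' : ConnOff G S v w) : ConnOff G S u w :=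
  ⟨h.1, h.2.trans h'.2⟩

theorem ConnOff.of_adj (ha : G.Adj u v) (hu : u ∉ S) (hv : v ∉ S) : ConnOff G S u v :=
  ⟨hu, .of_adj ha hv⟩

theorem ConnOff.step (h : ConnOff G S u v) (ha : G.Adj v w) (hw : w ∉ S) : ConnOff G S u w :=
  ⟨h.1, h.2.step ha hw⟩

theorem ConnOff.anti {T : Set V} (h : ConnOff G S u v) (hTS : T ⊆ S) : ConnOff G T u v :=
  ⟨fun hu => h.1 (hTS hu), h.2.mono (compl_subset_compl.2 hTS)⟩

theorem ConnOff.of_connSet (hX : ConnSet G X) (hXS : Disjoint X S) (hu : u ∈ X) (hv : v ∈ X) :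
    ConnOff G S u v :=
  ⟨disjoint_left.1 hXS hu, (hX.reach hu hv).mono (fun _ hx => disjoint_left.1 hXS hx)⟩

theorem ConnOff.induction_mem {P : V → Prop} (h : ConnOff G S u v) (h0 : P u)
    (hs : ∀ a b, ConnOff G S u a → P a → G.Adj a b → b ∉ S → P b) : P v := by
  have : ConnOff G S u v ∧ P v := by
    refine h.2.induction_mem (P := fun x => ConnOff G S u x ∧ P x) ⟨.refl h.1, h0⟩ ?_
    rintro a b ⟨h1, h2⟩ hab hb
    exact ⟨h1.step hab hb, hs a b h1 h2 hab hb⟩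
  exact this.2

/-- If the component of `u` in `G - S` avoids `T` then it is connected in `G - T`. -/
theorem ConnOff.change {T : Set V} (h : ConnOff G S u v)
    (hT : ∀ x, ConnOff G S u x → x ∉ T) : ConnOff G T u v := by
  refine h.induction_mem (P := fun x => ConnOff G T u x) (.refl (hT u (.refl h.1))) ?_
  intro a b ha hP hab hb
  exact hP.step hab (hT b (ha.step hab hb))

theorem ConnOff.map {f : V → V} (hf : ∀ x y, G.Adj x y → G.Adj (f x) (f y))
    (hS : ∀ x, x ∉ S → f x ∉ X) (h : ConnOff G S u v) : ConnOff G X (f u) (f v) := by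
  refine h.induction_mem (P := fun x => ConnOff G X (f u) (f x)) (.refl (hS u h.1)) ?_
  intro a b _ hP hab hb
  exact hP.step (hf _ _ hab) (hS b hb)

theorem ConnOff.of_preconnected (h : G.Connected) (u v : V) : ConnOff G ∅ u v := by
  have := h.preconnected u v
  rw [SimpleGraph.reachable_iff_reflTransGen] at this
  exact ⟨fun h => h, Relation.ReflTransGen.mono (fun a b h => ⟨h, by simp⟩) _ _ this⟩

/-- Closed under adjacency and nonempty means everything. -/
theorem eq_univ_of_adj_closed (h : G.Connected) {P : V → Prop} (hu : P u)
    (hs : ∀ a b, P a → G.Adj a b → P b) (v : V) : P v :=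
  (ConnOff.of_preconnected h u v).induction_mem hu fun a b _ ha hab _ => hs a b ha hab

end Reach

section Aut

variable {V : Type u} {E : V → V → Prop}

theorem IsAut.symm {ψ : Equiv.Perm V} (h : IsAut E ψ) : IsAut E ψ.symm := by
  intro x y
  rw [← h]; simp

theorem IsAut.trans {ψ φ : Equiv.Perm V} (h : IsAut E ψ) (h' : IsAut E φ) :
    IsAut E (ψ.trans φ) := by
  intro x y
  simp only [Equiv.trans_apply]
  rw [h', h]

theorem IsAut.flip {ψ : Equiv.Perm V} (h : IsAut E ψ) : IsAut (flip E) ψ := fun x y => h y x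

theorem UG_flip (E : V → V → Prop) : UG (flip E) = UG E := by
  ext x y
  simp only [UG, SimpleGraph.fromRel_adj, _root_.flip]
  tauto

theorem UG_adj_iff (hD : IsDigraph E) {x y : V} : (UG E).Adj x y ↔ E x y ∨ E y x := by
  simp only [UG, SimpleGraph.fromRel_adj]
  constructor
  · exact fun h => h.2
  · intro h
    refine ⟨?_, h⟩
    rintro rfl
    exact hD.1 x (by tauto)

theorem IsAut.adj {ψ : Equiv.Perm V} (h : IsAut E ψ) (x y : V) :
    (UG E).Adj (ψ x) (ψ y) ↔ (UG E).Adj x y := by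
  simp only [UG, SimpleGraph.fromRel_adj, h x y, h y x, ψ.injective.ne_iff]

theorem IsDigraph.flip (hD : IsDigraph E) : IsDigraph (flip E) :=
  ⟨hD.1, fun x y h h' => hD.2 y x h h'⟩

theorem DigraphCHom.flip (h : DigraphCHom E) : DigraphCHom (flip E) := by
  intro X Y hX hY hc φ hφ
  rw [UG_flip] at hc
  obtain ⟨ψ, h1, h2⟩ := h X Y hX hY hc φ (fun a b => hφ b a)
  exact ⟨ψ, fun x y => h1 y x, h2⟩

/-- A set of pairs that is a partial isomorphism of `E`. -/
def PIso (E : V → V → Prop) (P : Set (V × V)) : Prop :=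
  ∀ p ∈ P, ∀ q ∈ P, (p.1 = q.1 ↔ p.2 = q.2) ∧ (E p.1 q.1 ↔ E p.2 q.2)

/-- The diagonal over `M`. -/
def diagOn (M : Set V) : Set (V × V) := (fun x => (x, x)) '' M

theorem PIso.diagOn (E : V → V → Prop) (M : Set V) : PIso E (diagOn M) := by
  rintro _ ⟨x, -, rfl⟩ _ ⟨y, -, rfl⟩
  simp

theorem fst_diagOn (M : Set V) : Prod.fst '' diagOn M = M := by
  simp [diagOn, Set.image_image]

theorem PIso.empty (E : V → V → Prop) : PIso E ∅ := by
  rintro _ ⟨⟩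

theorem PIso.insert (hirr : ∀ x, ¬ E x x) {P : Set (V × V)} (h : PIso E P) {x y : V}
    (hxy : ∀ p ∈ P, (p.1 = x ↔ p.2 = y) ∧ (E p.1 x ↔ E p.2 y) ∧ (E x p.1 ↔ E y p.2)) :
    PIso E (insert (x, y) P) := by
  rintro p (rfl | hp) q (rfl | hq)
  · simp [hirr]
  · have := hxy q hq
    simp only [this, and_true]
    rw [eq_comm, this.1, eq_comm]
  · have := hxy p hp
    simp [this]
  · exact h p hp q hq

theorem DigraphCHom.extend (hhom : DigraphCHom E) {P : Set (V × V)} (hP : PIso E P)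
    (hf : P.Finite) (hc : ConnSet (UG E) (Prod.fst '' P)) :
    ∃ ψ : Equiv.Perm V, IsAut E ψ ∧ ∀ p ∈ P, ψ p.1 = p.2 := by
  classical
  have h1 : ∀ x : (Prod.fst '' P), ∃ q ∈ P, q.1 = x.1 := fun x => x.2
  choose f hfP hf1 using h1
  have h2 : ∀ x : (Prod.snd '' P), ∃ q ∈ P, q.2 = x.1 := fun x => x.2
  choose g hgP hg2 using h2
  let φ : (Prod.fst '' P) ≃ (Prod.snd '' P) :=
    { toFun := fun x => ⟨(f x).2, _, hfP x, rfl⟩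
      invFun := fun y => ⟨(g y).1, _, hgP y, rfl⟩
      left_inv := by
        intro x
        apply Subtype.ext
        simp only
        rw [← hf1 x]
        exact (hP _ (hgP _) _ (hfP x)).1.2 (by rw [hg2])
      right_inv := by
        intro y
        apply Subtype.ext
        simp only
        rw [← hg2 y]
        exact (hP _ (hfP _) _ (hgP y)).1.1 (by rw [hf1]) }
  obtain ⟨ψ, hψ, hψ2⟩ := hhom _ _ (hf.image _) (hf.image _) hc.induce φ (by
    intro a b
    show E a.1 b.1 ↔ E (f a).2 (f b).2
    rw [← hf1 a, ← hf1 b]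
    exact (hP _ (hfP a) _ (hfP b)).2)
  refine ⟨ψ, hψ, fun p hp => ?_⟩
  have := hψ2 ⟨p.1, p, hp, rfl⟩
  simp only at this
  rw [this]
  exact (hP _ (hfP _) _ hp).1.1 (hf1 _)

end Aut

section Basics

variable {V : Type u} {E : V → V → Prop}

theorem DigraphCHom.vertex_transitive (hhom : DigraphCHom E) (hirr : ∀ x, ¬ E x x) (u v : V) :
    ∃ ψ : Equiv.Perm V, IsAut E ψ ∧ ψ u = v := by
  obtain ⟨ψ, h1, h2⟩ := hhom.extend ((PIso.empty E).insert (x := u) (y := v) hirr (by simp))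
    (by simp) (by simpa using ConnSet.singleton u)
  exact ⟨ψ, h1, h2 (u, v) (by simp)⟩

/-- Fix `M` pointwise and move `x` to `y`. -/
theorem DigraphCHom.move_one (hhom : DigraphCHom E) (hirr : ∀ x, ¬ E x x) {M : Set V}
    (hM : M.Finite) {x y : V} (hx : x ∉ M) (hy : y ∉ M)
    (hxy : ∀ m ∈ M, (E m x ↔ E m y) ∧ (E x m ↔ E y m)) (hc : ConnSet (UG E) (insert x M)) :
    ∃ ψ : Equiv.Perm V, IsAut E ψ ∧ (∀ m ∈ M, ψ m = m) ∧ ψ x = y := by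
  obtain ⟨ψ, h1, h2⟩ := hhom.extend ((PIso.diagOn E M).insert (x := x) (y := y) hirr (by
      rintro _ ⟨m, hm, rfl⟩
      refine ⟨⟨?_, ?_⟩, hxy m hm⟩
      · rintro rfl; exact absurd hm hx
      · rintro rfl; exact absurd hm hy))
    ((hM.image _).insert _) (by simpa [image_insert_eq, fst_diagOn] using hc)
  exact ⟨ψ, h1, fun m hm => h2 (m, m) (Or.inr ⟨m, hm, rfl⟩), h2 (x, y) (by simp)⟩

/-- Fix `M` pointwise and move `x₁, x₂` to `y₁, y₂`. -/
theorem DigraphCHom.move_two (hhom : DigraphCHom E) (hirr : ∀ x, ¬ E x x) {M : Set V}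
    (hM : M.Finite) {x₁ y₁ x₂ y₂ : V} (hx₁ : x₁ ∉ M) (hy₁ : y₁ ∉ M) (hx₂ : x₂ ∉ M) (hy₂ : y₂ ∉ M)
    (h₁ : ∀ m ∈ M, (E m x₁ ↔ E m y₁) ∧ (E x₁ m ↔ E y₁ m))
    (h₂ : ∀ m ∈ M, (E m x₂ ↔ E m y₂) ∧ (E x₂ m ↔ E y₂ m))
    (hx : x₁ ≠ x₂) (hy : y₁ ≠ y₂) (h₁₂ : E x₁ x₂ ↔ E y₁ y₂) (h₂₁ : E x₂ x₁ ↔ E y₂ y₁)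
    (hc : ConnSet (UG E) (insert x₂ (insert x₁ M))) :
    ∃ ψ : Equiv.Perm V, IsAut E ψ ∧ (∀ m ∈ M, ψ m = m) ∧ ψ x₁ = y₁ ∧ ψ x₂ = y₂ := by
  obtain ⟨ψ, h1, h2⟩ := hhom.extend (((PIso.diagOn E M).insert (x := x₁) (y := y₁) hirr (by
      rintro _ ⟨m, hm, rfl⟩
      refine ⟨⟨?_, ?_⟩, h₁ m hm⟩
      · rintro rfl; exact absurd hm hx₁
      · rintro rfl; exact absurd hm hy₁)).insert (x := x₂) (y := y₂) hirr (by
      rintro _ (rfl | ⟨m, hm, rfl⟩)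
      · simp [hx, hy, h₁₂, h₂₁]
      refine ⟨⟨?_, ?_⟩, h₂ m hm⟩
      · rintro rfl; exact absurd hm hx₂
      · rintro rfl; exact absurd hm hy₂))
    (((hM.image _).insert _).insert _) (by simpa [image_insert_eq, fst_diagOn] using hc)
  exact ⟨ψ, h1, fun m hm => h2 (m, m) (Or.inr (Or.inr ⟨m, hm, rfl⟩)), h2 (x₁, y₁) (by simp),
    h2 (x₂, y₂) (by simp)⟩

theorem DigraphCHom.edge_transitive (hhom : DigraphCHom E) (hD : IsDigraph E) {u v u' v' : V}
    (h : E u v) (h' : E u' v') : ∃ ψ : Equiv.Perm V, IsAut E ψ ∧ ψ u = u' ∧ ψ v = v' := by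
  obtain ⟨ψ, h1, -, h2⟩ := hhom.move_two hD.1 (M := ∅) (by simp) (x₁ := u) (y₁ := u') (x₂ := v)
    (y₂ := v') (by simp) (by simp) (by simp) (by simp) (by simp) (by simp)
    (by rintro rfl; exact hD.1 _ h) (by rintro rfl; exact hD.1 _ h') (by simp [h, h'])
    (by simp [hD.2 _ _ h, hD.2 _ _ h']) (by
      have := (ConnSet.singleton (G := UG E) u).insert_adj (v := v) rfl
        ((UG_adj_iff hD).2 (Or.inl h))
      simpa using this)
  exact ⟨ψ, h1, h2⟩

theorem IsRay.infinite {G : SimpleGraph V} {r : ℕ → V} (h : IsRay G r) : Infinite V :=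
  Infinite.of_injective r h.1

theorem exists_edge_of_infinite [Infinite V] (hconn : (UG E).Connected) (hD : IsDigraph E) :
    ∃ u v, E u v := by
  by_contra hne
  push Not at hne
  obtain ⟨u, v, huv⟩ := exists_pair_ne V
  refine huv (eq_univ_of_adj_closed hconn (P := fun x => u = x) rfl ?_ v)
  intro a b _ hab
  rw [UG_adj_iff hD] at hab
  exact absurd hab (by simp [hne])

theorem exists_in_out [Infinite V] (hconn : (UG E).Connected) (hD : IsDigraph E)
    (hhom : DigraphCHom E) : (∀ x, ∃ y, E y x) ∧ ∀ x, ∃ y, E x y := by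
  obtain ⟨u, v, h⟩ := exists_edge_of_infinite hconn hD
  constructor
  · intro x
    obtain ⟨ψ, hψ, rfl⟩ := hhom.vertex_transitive hD.1 v x
    exact ⟨ψ u, (hψ _ _).2 h⟩
  · intro x
    obtain ⟨ψ, hψ, rfl⟩ := hhom.vertex_transitive hD.1 u x
    exact ⟨ψ v, (hψ _ _).2 h⟩

theorem IsRay.shift {G : SimpleGraph V} {r : ℕ → V} (h : IsRay G r) (N : ℕ) :
    IsRay G (fun n => r (n + N)) := by
  refine ⟨fun a b hab => by simpa using h.1 hab, fun n => ?_⟩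
  have := h.2 (n + N)
  rwa [show n + N + 1 = n + 1 + N by ring] at this

theorem IsRay.eventually_not_mem {G : SimpleGraph V} {r : ℕ → V} (h : IsRay G r) {S : Set V}
    (hS : S.Finite) : ∃ N, ∀ n, N ≤ n → r n ∉ S := by
  have : (r ⁻¹' S).Finite := hS.preimage h.1.injOn
  obtain ⟨N, hN⟩ := this.bddAbove
  refine ⟨N + 1, fun n hn hr => ?_⟩
  have := hN (show n ∈ r ⁻¹' S from hr)
  omega

theorem IsRay.connOff {G : SimpleGraph V} {r : ℕ → V} (h : IsRay G r) {S : Set V}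
    (hS : ∀ n, r n ∉ S) (n : ℕ) : ConnOff G S (r 0) (r n) := by
  induction n with
  | zero => exact .refl (hS 0)
  | succ n ih => exact ih.step (h.2 n) (hS _)

theorem isCompOf_connOff {G : SimpleGraph V} {S : Set V} {u : V} (hu : u ∉ S) :
    IsCompOf G {v | ConnOff G S u v} {v | v ∉ S} := by
  refine ⟨⟨u, .refl hu⟩, fun v hv => ConnOff.right hv, ConnSet.induce ?_, ?_⟩
  · refine ⟨u, .refl hu, fun x hx => ?_⟩
    refine ConnOff.induction_mem (P := fun x => ReachIn G {v | ConnOff G S u v} u x) hx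
      (.refl _) ?_
    intro a b ha hP hab hb
    exact hP.step hab (ha.step hab hb)
  · intro C' hC hC' hc
    refine Subset.antisymm (fun x hx => ?_) hC
    exact .of_connSet (.of_induce hc) (disjoint_left.2 fun a ha => hC' ha) (hC (.refl hu)) hx

/-- Two inequivalent rays have tails in different components after deleting a finite set. -/
theorem MoreThanOneEnd.exists_separator {G : SimpleGraph V} (h : MoreThanOneEnd G) :
    ∃ S : Set V, S.Finite ∧ ∃ r r', IsRay G r ∧ IsRay G r' ∧ (∀ n, r n ∉ S) ∧ (∀ n, r' n ∉ S) ∧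
      ¬ ConnOff G S (r 0) (r' 0) := by
  obtain ⟨r, r', hr, hr', hne⟩ := h
  unfold RayEquiv at hne
  push Not at hne
  obtain ⟨S, hS⟩ := hne
  obtain ⟨N, hN⟩ := hr.eventually_not_mem S.finite_toSet
  obtain ⟨N', hN'⟩ := hr'.eventually_not_mem S.finite_toSet
  have h1 : ∀ n, r (n + N) ∉ (S : Set V) := fun n => hN _ (by omega)
  have h2 : ∀ n, r' (n + N') ∉ (S : Set V) := fun n => hN' _ (by omega)
  refine ⟨S, S.finite_toSet, _, _, hr.shift N, hr'.shift N', h1, h2, fun hc => ?_⟩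
  refine hS _ (isCompOf_connOff (S := (S : Set V)) (h1 0)) ⟨N, fun n hn => ?_⟩
    ⟨N', fun n hn => ?_⟩
  · have := (hr.shift N).connOff h1 (n - N)
    simpa [Nat.sub_add_cancel hn] using this
  · have := hc.trans ((hr'.shift N').connOff h2 (n - N'))
    simpa [Nat.sub_add_cancel hn] using this

/-- A vertex whose removal from the separator joins `u` and `v` has a neighbour in the
component of `u`. -/
theorem exists_adj_of_connOff_diff {G : SimpleGraph V} {S : Set V} {s u v : V} (hu : u ∉ S)
    (h : ConnOff G (S \ {s}) u v) (hn : ¬ ConnOff G S u v) : ∃ y, G.Adj s y ∧ ConnOff G S u y := by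
  by_contra hne
  push Not at hne
  refine hn (h.induction_mem (P := fun x => ConnOff G S u x) (.refl hu) ?_)
  intro a b _ hP hab hb
  by_cases hbs : b = s
  · subst hbs
    exact absurd hP (hne a hab.symm)
  · exact hP.step hab fun hbS => hb ⟨hbS, hbs⟩

end Basics

/-- A directed walk of length `m`. -/
def DWalk {V : Type u} (E : V → V → Prop) (m : ℕ) (p : ℕ → V) : Prop :=
  ∀ i < m, E (p i) (p (i + 1))

/-- Put `w` in front of a sequence. -/
def prependSeq {V : Type u} (w : V) (p : ℕ → V) : ℕ → V
  | 0 => w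
  | i + 1 => p i

section Walks

variable {V : Type u} {E : V → V → Prop} {m : ℕ} {p : ℕ → V}

theorem DWalk.mono (h : DWalk E m p) {l : ℕ} (hl : l ≤ m) : DWalk E l p :=
  fun i hi => h i (by omega)

theorem DWalk.shift {d : ℕ} (h : DWalk E (m + d) p) : DWalk E m (fun i => p (i + d)) := by
  intro i hi
  have := h (i + d) (by omega)
  rwa [show i + d + 1 = i + 1 + d by ring] at this

theorem DWalk.prepend (h : DWalk E m p) {w : V} (hw : E w (p 0)) :
    DWalk E (m + 1) (prependSeq w p) := by
  intro i hi
  cases i with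
  | zero => exact hw
  | succ i => exact h i (by omega)

theorem DWalk.snoc (h : DWalk E m p) {y : V} (hy : E (p m) y) :
    DWalk E (m + 1) (Function.update p (m + 1) y) := by
  intro i hi
  rw [Function.update_of_ne (by omega)]
  by_cases him : i = m
  · subst him; simpa using hy
  · rw [Function.update_of_ne (by omega)]
    exact h i (by omega)

theorem DWalk.reverse (h : DWalk E m p) : DWalk (flip E) m (fun i => p (m - i)) := by
  intro i hi
  have := h (m - (i + 1)) (by omega)
  rwa [show m - (i + 1) + 1 = m - i by omega] at this

theorem DWalk.of_reverse (h : DWalk (flip E) m p) : DWalk E m (fun i => p (m - i)) := h.reverse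

theorem DWalk.map (h : DWalk E m p) {ψ : Equiv.Perm V} (hψ : IsAut E ψ) :
    DWalk E m (fun i => ψ (p i)) := fun i hi => (hψ _ _).2 (h i hi)

theorem exists_dWalk (hout : ∀ x, ∃ y, E x y) (x : V) : ∃ p : ℕ → V, p 0 = x ∧ ∀ m, DWalk E m p := by
  choose f hf using hout
  refine ⟨fun n => Nat.rec x (fun _ y => f y) n, rfl, fun m i _ => hf _⟩

theorem DWalk.connSet (h : DWalk E m p) (hD : IsDigraph E) :
    ConnSet (UG E) {x | ∃ i ≤ m, p i = x} :=
  ConnSet.of_path p m fun i hi => (UG_adj_iff hD).2 (Or.inl (h i hi))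

end Walks

/-- A triangle-free C-homogeneous digraph in which every directed walk of length less than
`k + 3` is an induced path, and in which some finite vertex set separates two vertices. -/
structure ArcData {V : Type u} (E : V → V → Prop) (k : ℕ) : Prop where
  dig : IsDigraph E
  hom : DigraphCHom E
  conn : (UG E).Connected
  inf : Infinite V
  tri : ¬ HasTriangle E
  ind : ∀ m < k + 3, ∀ p, DWalk E m p → ∀ i j, i ≤ m → j ≤ m → E (p i) (p j) → j = i + 1
  inj : ∀ m ≤ k + 3, ∀ p, DWalk E m p → ∀ i j, i ≤ m → j ≤ m → p i = p j → i = j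
  inn : ∀ x, ∃ y, E y x
  out : ∀ x, ∃ y, E x y
  sep : ∃ S : Set V, S.Finite ∧ ∃ u v, u ∉ S ∧ v ∉ S ∧ ¬ ConnOff (UG E) S u v

theorem HasTriangle.flip {V : Type u} {E : V → V → Prop} (h : HasTriangle (flip E)) :
    HasTriangle E := by
  rw [HasTriangle, UG_flip] at h
  exact h

section ArcData

variable {V : Type u} {E : V → V → Prop} {k : ℕ}

theorem ArcData.flip (A : ArcData E k) : ArcData (flip E) k where
  dig := A.dig.flip
  hom := A.hom.flip
  conn := by rw [UG_flip]; exact A.conn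
  inf := A.inf
  tri := fun h => A.tri h.flip
  ind := by
    intro m hm p hp i j hi hj hij
    have := A.ind m hm _ hp.of_reverse (m - j) (m - i) (by omega) (by omega) (by
      simpa [_root_.flip, Nat.sub_sub_self hi, Nat.sub_sub_self hj] using hij)
    omega
  inj := by
    intro m hm p hp i j hi hj hij
    have := A.inj m hm _ hp.of_reverse (m - j) (m - i) (by omega) (by omega) (by
      simpa [Nat.sub_sub_self hi, Nat.sub_sub_self hj] using hij.symm)
    omega
  inn := A.out
  out := A.inn
  sep := by rw [UG_flip]; exact A.sep

theorem ArcData.no_tri (A : ArcData E k) {x y z : V} (h1 : (UG E).Adj x y) (h2 : (UG E).Adj x z)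
    (h3 : (UG E).Adj y z) : False := A.tri ⟨x, y, z, h1, h3, h2⟩

theorem ArcData.chord (A : ArcData E k) {p : ℕ → V} (hp : DWalk E (k + 3) p) {i j : ℕ}
    (hi : i ≤ k + 3) (hj : j ≤ k + 3) (h : E (p i) (p j)) :
    j = i + 1 ∨ (i = 0 ∧ j = k + 3) ∨ (i = k + 3 ∧ j = 0) := by
  by_cases h1 : i < k + 3 ∧ j < k + 3
  · left
    exact A.ind (k + 2) (by omega) p (hp.mono (by omega)) i j (by omega) (by omega) h
  by_cases h2 : 0 < i ∧ 0 < j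
  · have := A.ind (k + 2) (by omega) _ (DWalk.shift (d := 1) hp) (i - 1) (j - 1) (by omega)
      (by omega) (by simpa [Nat.sub_add_cancel h2.1, Nat.sub_add_cancel h2.2] using h)
    left; omega
  · have : i ≠ j := by rintro rfl; exact A.dig.1 _ h
    omega

theorem ArcData.walk_transitive (A : ArcData E k) {m : ℕ} (hm : m < k + 3) {p q : ℕ → V}
    (hp : DWalk E m p) (hq : DWalk E m q) :
    ∃ ψ : Equiv.Perm V, IsAut E ψ ∧ ∀ i ≤ m, ψ (p i) = q i := by
  have hE : ∀ r, DWalk E m r → ∀ i j, i ≤ m → j ≤ m → (E (r i) (r j) ↔ j = i + 1) := by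
    intro r hr i j hi hj
    exact ⟨A.ind m hm r hr i j hi hj, by rintro rfl; exact hr i (by omega)⟩
  have hI : ∀ r, DWalk E m r → ∀ i j, i ≤ m → j ≤ m → (r i = r j ↔ i = j) := by
    intro r hr i j hi hj
    exact ⟨A.inj m (by omega) r hr i j hi hj, by rintro rfl; rfl⟩
  obtain ⟨ψ, h1, h2⟩ := A.hom.extend (P := (fun i => (p i, q i)) '' {i | i ≤ m}) (by
      rintro _ ⟨i, hi, rfl⟩ _ ⟨j, hj, rfl⟩
      simp only [mem_ofPred_eq] at hi hj
      simp only [hE p hp i j hi hj, hE q hq i j hi hj, hI p hp i j hi hj, hI q hq i j hi hj,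
        and_self])
    ((Set.finite_Iic m).image _) (by
      have := hp.connSet A.dig
      rw [image_image]
      exact this)
  exact ⟨ψ, h1, fun i hi => h2 (p i, q i) ⟨i, hi, rfl⟩⟩

theorem ArcData.in_finite (A : ArcData E k) {x : V} (h : {y | E y x}.Finite) (z : V) :
    {y | E y z}.Finite := by
  obtain ⟨ψ, hψ, rfl⟩ := A.hom.vertex_transitive A.dig.1 x z
  refine (h.image ψ).subset fun y hy => ⟨ψ.symm y, ?_, by simp⟩
  rw [mem_ofPred_eq, ← hψ]; simpa using hy

theorem ArcData.in_ncard (A : ArcData E k) (x z : V) :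
    {y | E y x}.ncard = {y | E y z}.ncard := by
  obtain ⟨ψ, hψ, rfl⟩ := A.hom.vertex_transitive A.dig.1 x z
  rw [← ncard_image_of_injective _ ψ.injective]
  congr 1
  ext y
  constructor
  · rintro ⟨y, hy, rfl⟩; exact (hψ _ _).2 hy
  · intro hy
    exact ⟨ψ.symm y, by rw [mem_ofPred_eq, ← hψ]; simpa using hy, by simp⟩

theorem ArcData.out_finite (A : ArcData E k) {x : V} (h : {y | E x y}.Finite) (z : V) :
    {y | E z y}.Finite := A.flip.in_finite h z

theorem ArcData.out_ncard (A : ArcData E k) (x z : V) :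
    {y | E x y}.ncard = {y | E z y}.ncard := A.flip.in_ncard x z

theorem ArcData.not_all_forward (A : ArcData E k) (hB : ∀ p, DWalk E (k + 3) p → E (p 0) (p (k + 3)))
    (x : V) (hf : {y | E y x}.Finite) : False := by
  obtain ⟨r, -, hr⟩ := exists_dWalk A.out x
  have hsub : {y | E y (r 0)} ⊆ {y | E y (r (k + 2))} := by
    intro y hy
    have := hB _ ((hr (k + 2)).prepend hy)
    simpa [prependSeq] using this
  have := Set.eq_of_subset_of_ncard_le hsub (A.in_ncard _ _).ge (A.in_finite hf _)
  have h2 : r (k + 1) ∈ {y | E y (r 0)} := by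
    rw [this]; exact hr (k + 2) (k + 1) (by omega)
  have := A.ind (k + 1) (by omega) r (hr _) (k + 1) 0 le_rfl (by omega) h2
  omega

theorem ArcData.not_all_backward (A : ArcData E k) (hA : ∀ p, DWalk E (k + 3) p → E (p (k + 3)) (p 0))
    (x : V) (hf : {y | E x y}.Finite) : False := by
  let R : ℕ → Set V := fun m => {v | ∃ p, DWalk E m p ∧ p 0 = x ∧ p m = v}
  have hR0 : R 0 = {x} := by
    ext v
    constructor
    · rintro ⟨p, -, h1, h2⟩; rw [← h2, h1]; rfl
    · rintro rfl; exact ⟨fun _ => v, fun i hi => absurd hi (by omega), rfl, rfl⟩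
  have hRs : ∀ m, ∀ v ∈ R m, ∀ w, E v w → w ∈ R (m + 1) := by
    rintro m v ⟨p, hp, h0, rfl⟩ w hw
    exact ⟨_, hp.snoc hw, by rw [Function.update_of_ne (by omega)]; exact h0, by simp⟩
  have hRf : ∀ m, (R m).Finite := by
    intro m
    induction m with
    | zero => rw [hR0]; exact finite_singleton x
    | succ m ih =>
      refine (ih.biUnion (t := fun v => {y | E v y}) fun v _ => A.out_finite hf v).subset ?_
      rintro v ⟨p, hp, h0, rfl⟩
      exact mem_biUnion (show p m ∈ R m from ⟨p, hp.mono (by omega), h0, rfl⟩) (hp m (by omega))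
  have hshort : ∀ p, DWalk E (k + 5) p → E (p 0) (p (k + 5)) := by
    intro p hp
    have h1 : E (p (k + 5)) (p 2) := by simpa using hA _ (DWalk.shift (d := 2) hp)
    have h2 : E (p (k + 3)) (p 0) := hA _ (hp.mono (by omega))
    have h3 : DWalk E (k + 1) (fun i => p (i + 2)) := DWalk.shift (hp.mono (by omega))
    have h4 := (h3.snoc (y := p 0) (by simpa using h2)).prepend (w := p (k + 5)) (by
      rw [Function.update_of_ne (by omega)]; simpa using h1)
    have h5 := hA _ h4
    simpa [prependSeq] using h5
  let U : Set V := ⋃ m ∈ Iic (k + 4), R m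
  have hUf : U.Finite := (finite_Iic _).biUnion fun m _ => hRf m
  have hUs : ∀ v ∈ U, ∀ w, E v w → w ∈ U := by
    intro v hv w hw
    obtain ⟨m, hm, hv⟩ := mem_iUnion₂.1 hv
    have hw' := hRs m v hv w hw
    by_cases hmk : m = k + 4
    · subst hmk
      obtain ⟨p, hp, h0, h1⟩ := hw'
      have := hshort p hp
      rw [h0, h1] at this
      exact mem_biUnion (show (0 + 1) ∈ Iic (k + 4) by simp) (hRs 0 x (by rw [hR0]; rfl) w this)
    · exact mem_biUnion (show m + 1 ∈ Iic (k + 4) by simp at hm ⊢; omega) hw'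
  have hUw : ∀ m, ∀ p, DWalk E m p → p 0 ∈ U → p m ∈ U := by
    intro m p hp h0
    induction m with
    | zero => exact h0
    | succ m ih => exact hUs _ (ih (hp.mono (by omega))) _ (hp m (by omega))
  have hUi : ∀ v ∈ U, ∀ w, E w v → w ∈ U := by
    intro v hv w hw
    obtain ⟨r, h0, hr⟩ := exists_dWalk A.out v
    have h1 : E (r (k + 2)) w := by
      have := hA _ ((hr (k + 2)).prepend (w := w) (by rw [h0]; exact hw))
      simpa [prependSeq] using this
    have h2 := (hr (k + 2)).snoc h1
    have := hUw _ _ h2 (by rw [Function.update_of_ne (by omega), h0]; exact hv)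
    simpa using this
  have hUu : U = univ := by
    refine eq_univ_of_forall (eq_univ_of_adj_closed A.conn (P := fun v => v ∈ U) (u := x)
      (mem_biUnion (show 0 ∈ Iic (k + 4) by simp) (by rw [hR0]; rfl)) ?_)
    intro a b ha hab
    rcases (UG_adj_iff A.dig).1 hab with h | h
    · exact hUs a ha b h
    · exact hUi a ha b h
  have := A.inf
  exact infinite_univ (hUu ▸ hUf)

end ArcData

section ArcData

variable {V : Type u} {E : V → V → Prop} {k : ℕ}

/-- A smallest separating set: removing any of its vertices reconnects. -/
theorem ArcData.exists_min_sep (A : ArcData E k) : ∃ S : Set V, S.Finite ∧ ∃ u v, u ∉ S ∧ v ∉ S ∧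
    ¬ ConnOff (UG E) S u v ∧ S.Nonempty ∧ ∀ s ∈ S, ConnOff (UG E) (S \ {s}) u v := by
  classical
  have hex : ∃ m, ∃ S : Set V, S.Finite ∧ S.ncard = m ∧ ∃ u v, u ∉ S ∧ v ∉ S ∧
      ¬ ConnOff (UG E) S u v := by
    obtain ⟨S, hS, h⟩ := A.sep
    exact ⟨_, S, hS, rfl, h⟩
  obtain ⟨S, hS, hcard, u, v, hu, hv, hn⟩ := Nat.find_spec hex
  refine ⟨S, hS, u, v, hu, hv, hn, ?_, fun s hs => ?_⟩
  · by_contra hne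
    rw [not_nonempty_iff_eq_empty] at hne
    exact hn (hne ▸ ConnOff.of_preconnected A.conn u v)
  · by_contra hc
    refine Nat.find_min hex (m := (S \ {s}).ncard) ?_ ⟨S \ {s}, hS.sdiff, rfl, u, v,
      fun h => hu h.1, fun h => hv h.1, hc⟩
    rw [← hcard]
    exact ncard_sdiff_singleton_lt_of_mem hs hS

theorem ArcData.row_image_finite (A : ArcData E k) {p q : ℕ → V} (hp : DWalk E (k + 2) p)
    (hq : DWalk E (k + 2) q) (h : {y | E (p (k + 2)) y ∧ (UG E).Adj (p 0) y}.Finite) :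
    {y | E (q (k + 2)) y ∧ (UG E).Adj (q 0) y}.Finite := by
  obtain ⟨ψ, hψ, h1⟩ := A.walk_transitive (by omega) hp hq
  refine (h.image ψ).subset ?_
  rintro y ⟨hy1, hy2⟩
  rw [← h1 _ le_rfl] at hy1
  rw [← h1 0 (by omega)] at hy2
  refine ⟨ψ.symm y, ⟨?_, ?_⟩, by simp⟩
  · rw [← hψ]; simpa using hy1
  · rw [← hψ.adj]; simpa using hy2

/-- For a directed walk of length `k + 2`, only finitely many out-neighbours of its last vertex
are adjacent to its first vertex. -/
theorem ArcData.row_finite (A : ArcData E k) {p : ℕ → V} (hp : DWalk E (k + 2) p) :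
    {y | E (p (k + 2)) y ∧ (UG E).Adj (p 0) y}.Finite := by
  by_contra hinf
  have hall : ∀ q, DWalk E (k + 2) q → {y | E (q (k + 2)) y ∧ (UG E).Adj (q 0) y}.Infinite :=
    fun q hq hfin => hinf (A.row_image_finite hq hp hfin)
  have hout : ∀ x, {y | E x y}.Infinite := by
    intro x hx
    exact hall p hp ((A.out_finite hx (p (k + 2))).subset fun y hy => hy.1)
  obtain ⟨S, hS, u, v, hu, hv, hn, ⟨s, hs⟩, hmin⟩ := A.exists_min_sep
  by_cases hC : ∃ s ∈ S, ∃ x₀ x₂, x₀ ∉ S ∧ x₂ ∉ S ∧ E x₀ s ∧ E s x₂ ∧ ¬ ConnOff (UG E) S x₀ x₂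
  · obtain ⟨s, hs, x₀, x₂, hx₀, hx₂, h0, h2, hno⟩ := hC
    have hnext : ∀ x, ∃ y, E x y ∧ y ∉ S := fun x => by
      obtain ⟨y, hy, hyS⟩ := (hout x).exists_notMem_finite hS
      exact ⟨y, hy, hyS⟩
    choose f hf hfS using hnext
    let r : ℕ → V := fun n => Nat.rec x₂ (fun _ y => f y) n
    have hr : ∀ m, DWalk E m r := fun m i _ => hf _
    have hrc : ∀ i, ConnOff (UG E) S x₂ (r i) := by
      intro i
      induction i with
      | zero => exact .refl hx₂
      | succ i ih => exact ih.step ((UG_adj_iff A.dig).2 (Or.inl (hf _))) (hfS _)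
    have hw := ((hr k).prepend (w := s) h2).prepend (w := x₀) h0
    obtain ⟨y, ⟨hy1, hy2⟩, hyS⟩ := (hall _ hw).exists_notMem_finite hS
    simp only [prependSeq] at hy1 hy2
    exact hno (((hrc k).step ((UG_adj_iff A.dig).2 (Or.inl hy1)) hyS).step hy2.symm hx₀).symm
  · push Not at hC
    have hin : ∀ x, {y | E y x}.Finite := by
      refine A.in_finite (x := s) (hS.subset ?_)
      intro x hx
      by_contra hxS
      obtain ⟨t, ht, htS⟩ := (hout s).exists_notMem_finite hS
      have hxt := hC s hs x t hxS htS hx ht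
      have hall : ∀ y, (UG E).Adj s y → y ∉ S → ConnOff (UG E) S x y := by
        intro y hy hyS
        rcases (UG_adj_iff A.dig).1 hy with h | h
        · exact hC s hs x y hxS hyS hx h
        · exact hxt.trans (hC s hs y t hyS htS h ht).symm
      obtain ⟨y, hy, huy⟩ := exists_adj_of_connOff_diff hu (hmin s hs) hn
      obtain ⟨z, hz, hvz⟩ := exists_adj_of_connOff_diff hv (hmin s hs).symm fun h => hn h.symm
      exact hn ((huy.trans (hall y hy huy.right).symm).trans
        ((hall z hz hvz.right).trans hvz.symm))
    refine A.not_all_forward ?_ s (hin s)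
    intro p' hp'
    let q : ℕ → V := fun i => p' (i + 1)
    have hq : DWalk E (k + 1) q := (hp'.mono (show k + 1 + 1 ≤ k + 3 by omega)).shift
    let x := p' 0
    have hx : E x (q 0) := hp' 0 (by omega)
    let M : Set V := {x | ∃ i ≤ k + 1, q i = x}
    have hMf : M.Finite := (finite_Iic (k + 1)).image q
    have hMq : q (k + 1) ∈ M := ⟨_, le_rfl, rfl⟩
    have hMc : ConnSet (UG E) M := hq.connSet A.dig
    have hYM : ∀ y, E (q (k + 1)) y → y ∉ M ∧ ∀ i ≤ k + 1, (E (q i) y ↔ i = k + 1) ∧ ¬ E y (q i) := by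
      intro y hy
      have hw := hq.snoc hy
      have hlast : Function.update q (k + 1 + 1) y (k + 2) = y := by simp
      have hoth : ∀ i ≤ k + 1, Function.update q (k + 1 + 1) y i = q i :=
        fun i hi => Function.update_of_ne (by omega) _ _
      refine ⟨?_, fun i hi => ⟨⟨fun h => ?_, ?_⟩, fun h => ?_⟩⟩
      · rintro ⟨i, hi, hiy⟩
        have := A.inj _ (by omega) _ hw i (k + 2) (by omega) le_rfl (by rw [hlast, hoth i hi, hiy])
        omega
      · have := A.ind _ (by omega) _ hw i (k + 2) (by omega) le_rfl (by rwa [hlast, hoth i hi])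
        omega
      · rintro rfl; exact hy
      · have := A.ind _ (by omega) _ hw (k + 2) i le_rfl (by omega) (by rwa [hlast, hoth i hi])
        omega
    have hY : {y | E (q (k + 1)) y}.Infinite := hout _
    let X : Set V := {x | E x (q 0)}
    let sig : V → Set V × Set V := fun y => ({x ∈ X | E x y}, {x ∈ X | E y x})
    have hmaps : MapsTo sig {y | E (q (k + 1)) y} (𝒫 X ×ˢ 𝒫 X) :=
      fun y _ => ⟨fun x hx => hx.1, fun x hx => hx.1⟩
    obtain ⟨y, hy, y', hy', hne, hsig⟩ := hY.exists_ne_map_eq_of_mapsTo hmaps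
      ((hin (q 0)).powerset.prod (hin (q 0)).powerset)
    have hsig' : ∀ x ∈ X, (E x y ↔ E x y') ∧ (E y x ↔ E y' x) := by
      intro x hx
      have h1 := Set.ext_iff.1 (congrArg Prod.fst hsig) x
      have h2 := Set.ext_iff.1 (congrArg Prod.snd hsig) x
      simp only [sig, mem_ofPred_eq] at h1 h2
      exact ⟨by simpa [hx] using h1, by simpa [hx] using h2⟩
    have hnon : ∀ y₁ y₂, E (q (k + 1)) y₁ → E (q (k + 1)) y₂ → ¬ E y₁ y₂ := by
      intro y₁ y₂ h1 h2 h
      exact A.no_tri ((UG_adj_iff A.dig).2 (Or.inl h1)) ((UG_adj_iff A.dig).2 (Or.inl h2))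
        ((UG_adj_iff A.dig).2 (Or.inl h))
    have huni : ∀ y₁ y₂, E (q (k + 1)) y₁ → E (q (k + 1)) y₂ → ∀ x ∈ X,
        (E x y₁ ↔ E x y₂) ∧ (E y₁ x ↔ E y₂ x) := by
      intro y₁ y₂ h1 h2 x hx
      by_cases h12 : y₁ = y₂
      · subst h12; simp
      have hM : ∀ a b, E (q (k + 1)) a → E (q (k + 1)) b →
          ∀ m ∈ M, (E m a ↔ E m b) ∧ (E a m ↔ E b m) := by
        rintro a b ha hb _ ⟨i, hi, rfl⟩
        have h1 := (hYM a ha).2 i hi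
        have h2 := (hYM b hb).2 i hi
        tauto
      obtain ⟨ψ, hψ, hψM, rfl, rfl⟩ := A.hom.move_two A.dig.1 hMf (hYM y hy).1 (hYM y₁ h1).1
        (hYM y' hy').1 (hYM y₂ h2).1 (hM _ _ hy h1) (hM _ _ hy' h2) hne h12
        (by simp [hnon _ _ hy hy', hnon _ _ h1 h2]) (by simp [hnon _ _ hy' hy, hnon _ _ h2 h1])
        ((hMc.insert_adj hMq ((UG_adj_iff A.dig).2 (Or.inl hy))).insert_adj (Or.inr hMq)
          ((UG_adj_iff A.dig).2 (Or.inl hy')))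
      have hx' : ψ.symm x ∈ X := by
        show E _ _
        rw [← hψ, hψM (q 0) ⟨0, by omega, rfl⟩, Equiv.apply_symm_apply]; exact hx
      have := hsig' _ hx'
      rw [← hψ _ y, ← hψ _ y', ← hψ y, ← hψ y', Equiv.apply_symm_apply] at this
      exact this
    have hrow := hall _ (hq.prepend (w := x) hx)
    obtain ⟨y₀, hy₀, hxy₀⟩ := hrow.nonempty
    simp only [prependSeq] at hy₀ hxy₀
    have hplast : E (q (k + 1)) (p' (k + 3)) := hp' (k + 2) (by omega)
    rcases (UG_adj_iff A.dig).1 hxy₀ with h | h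
    · exact ((huni _ _ hy₀ hplast x hx).1).1 h
    · exact absurd ((hin x).subset fun y hy => ((huni _ _ hy₀ hy x hx).2).1 h) hY

theorem ArcData.col_finite (A : ArcData E k) {p : ℕ → V} (hp : DWalk E (k + 2) p) :
    {x | E x (p 0) ∧ (UG E).Adj (p (k + 2)) x}.Finite := by
  have := A.flip.row_finite hp.reverse
  rw [UG_flip] at this
  simpa [_root_.flip] using this

end ArcData

section ArcData

variable {V : Type u} {E : V → V → Prop} {k : ℕ}

/-- Distinct in-neighbours of `a` have the same in-neighbours. -/
def SharesIn (E : V → V → Prop) (a : V) : Prop :=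
  ∀ z y, E z a → E y a → z ≠ y → ∀ w, E w z → E w y

/-- There are distinct in-neighbours of `a`, and any in-neighbour of one of them is an
out-neighbour of the others. -/
def ReversesIn (E : V → V → Prop) (a : V) : Prop :=
  (∃ z z', E z a ∧ E z' a ∧ z ≠ z') ∧ ∀ z z', E z a → E z' a → z ≠ z' → ∀ w, E w z → E z' w

theorem image_eq_self_of_mapsTo_iff {f : Equiv.Perm V} {I J : Set V}
    (h : ∀ y, y ∈ I ↔ f y ∈ J) (hfix : ∀ y ∈ I, f y = y) : J = I := by
  ext y
  constructor
  · intro hy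
    have h1 : f.symm y ∈ I := by rw [h]; simpa using hy
    have := hfix _ h1
    rw [Equiv.apply_symm_apply] at this
    rwa [this]
  · intro hy
    rw [← hfix y hy]; exact (h y).1 hy

theorem ArcData.sharesIn_or_reversesIn (A : ArcData E k) {Q : V → V → Prop}
    (hQ : ∀ ψ : Equiv.Perm V, IsAut E ψ → ∀ x y, Q (ψ x) (ψ y) ↔ Q x y)
    {q : ℕ → V} (hq : DWalk E k q)
    (hrow : ∀ w z, E w z → E z (q 0) → {y | E (q k) y ∧ Q w y}.Finite ∧
      (∃ y, E (q k) y ∧ Q w y) ∧ ∃ y, E (q k) y ∧ ¬ Q w y) :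
    SharesIn E (q 0) ∨ ReversesIn E (q 0) := by
  set a := q 0 with ha
  set b := q k with hb
  let M : Set V := {x | ∃ i ≤ k, q i = x}
  have hMf : M.Finite := (finite_Iic k).image q
  have haM : a ∈ M := ⟨0, by omega, rfl⟩
  have hbM : b ∈ M := ⟨k, le_rfl, rfl⟩
  have hMc : ConnSet (UG E) M := hq.connSet A.dig
  have irr := A.dig.1
  have asym := A.dig.2
  have adjl : ∀ {x y}, E x y → (UG E).Adj x y := fun h => (UG_adj_iff A.dig).2 (Or.inl h)
  have adjr : ∀ {x y}, E y x → (UG E).Adj x y := fun h => (UG_adj_iff A.dig).2 (Or.inr h)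
  -- relations of in-neighbours of `a` to `M`
  have hZM : ∀ z, E z a → z ∉ M ∧ ∀ m ∈ M, (E z m ↔ m = a) ∧ ¬ E m z := by
    intro z hz
    have hw := hq.prepend hz
    refine ⟨?_, ?_⟩
    · rintro ⟨i, hi, h⟩
      have := A.inj _ (by omega) _ hw (i + 1) 0 (by omega) (by omega) h
      omega
    · rintro _ ⟨i, hi, rfl⟩
      refine ⟨⟨fun h => ?_, fun h => h ▸ hz⟩, fun h => ?_⟩
      · have := A.ind _ (by omega) _ hw 0 (i + 1) (by omega) (by omega) h
        rw [show i = 0 by omega]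
      · have := A.ind _ (by omega) _ hw (i + 1) 0 (by omega) (by omega) h
        omega
  have hYM : ∀ y, E b y → y ∉ M ∧ ∀ m ∈ M, (E m y ↔ m = b) ∧ ¬ E y m := by
    intro y hy
    have hw := hq.snoc hy
    have hlast : Function.update q (k + 1) y (k + 1) = y := by simp
    have hoth : ∀ i ≤ k, Function.update q (k + 1) y i = q i :=
      fun i hi => Function.update_of_ne (by omega) _ _
    refine ⟨?_, ?_⟩
    · rintro ⟨i, hi, hiy⟩
      have := A.inj _ (by omega) _ hw i (k + 1) (by omega) le_rfl (by rw [hlast, hoth i hi, hiy])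
      omega
    · rintro _ ⟨i, hi, rfl⟩
      refine ⟨⟨fun h => ?_, fun h => h ▸ hy⟩, fun h => ?_⟩
      · have := A.ind _ (by omega) _ hw i (k + 1) (by omega) le_rfl (by rwa [hlast, hoth i hi])
        rw [show i = k by omega]
      · have := A.ind _ (by omega) _ hw (k + 1) i le_rfl (by omega) (by rwa [hlast, hoth i hi])
        omega
  have hZY : ∀ z y, E z a → E b y → z ≠ y ∧ ¬ E z y ∧ ¬ E y z := by
    intro z y hz hy
    have hw := (hq.snoc hy).prepend (w := z) (by rw [Function.update_of_ne (by omega)]; exact hz)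
    have h0 : prependSeq z (Function.update q (k + 1) y) 0 = z := rfl
    have h1 : prependSeq z (Function.update q (k + 1) y) (k + 2) = y := by simp [prependSeq]
    refine ⟨fun h => ?_, fun h => ?_, fun h => ?_⟩
    · have := A.inj _ (by omega) _ hw 0 (k + 2) (by omega) (by omega) (by rw [h0, h1]; exact h)
      omega
    · have := A.ind _ (by omega) _ hw 0 (k + 2) (by omega) (by omega) (by rw [h0, h1]; exact h)
      omega
    · have := A.ind _ (by omega) _ hw (k + 2) 0 (by omega) (by omega) (by rw [h0, h1]; exact h)
      omega
  have hWM : ∀ w z, E z a → E w z → w ∉ M ∧ ∀ m ∈ M, ¬ E w m ∧ ¬ E m w := by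
    intro w z hz hwz
    have hw := (hq.prepend hz).prepend (w := w) hwz
    refine ⟨?_, ?_⟩
    · rintro ⟨i, hi, h⟩
      have := A.inj _ (by omega) _ hw (i + 2) 0 (by omega) (by omega) h
      omega
    · rintro _ ⟨i, hi, rfl⟩
      refine ⟨fun h => ?_, fun h => ?_⟩
      · have := A.ind _ (by omega) _ hw 0 (i + 2) (by omega) (by omega) h
        omega
      · have := A.ind _ (by omega) _ hw (i + 2) 0 (by omega) (by omega) h
        omega
  have hZZ : ∀ z z', E z a → E z' a → ¬ E z z' := fun z z' h h' hzz =>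
    A.no_tri (adjr h) (adjr h') (adjl hzz)
  have hYY : ∀ y y', E b y → E b y' → ¬ E y y' := fun y y' h h' hyy =>
    A.no_tri (adjl h) (adjl h') (adjl hyy)
  have hWW : ∀ z w w', E w z → E w' z → ¬ E w w' := fun z w w' h h' hww =>
    A.no_tri (adjr h) (adjr h') (adjl hww)
  have hWZ : ∀ w z z', E z a → E w z → E z' a → w ≠ z' := by
    rintro w z _ hz hwz hz' rfl
    exact (hWM w z hz hwz).2 a haM |>.1 hz'
  let row : V → Set V := fun w => {y | E b y ∧ Q w y}
  have hrowmap : ∀ g : Equiv.Perm V, IsAut E g → (∀ m ∈ M, g m = m) → ∀ w y,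
      y ∈ row w ↔ g y ∈ row (g w) := by
    intro g hg hgM w y
    show (E b y ∧ Q w y) ↔ (E b (g y) ∧ Q (g w) (g y))
    rw [hQ g hg, ← hg b y, hgM b hbM]
  have hrelZ : ∀ z z', E z a → E z' a → ∀ m ∈ M, (E m z ↔ E m z') ∧ (E z m ↔ E z' m) := by
    intro z z' h h' m hm
    have h1 := (hZM z h).2 m hm
    have h2 := (hZM z' h').2 m hm
    tauto
  have hrelY : ∀ y y', E b y → E b y' → ∀ m ∈ M, (E m y ↔ E m y') ∧ (E y m ↔ E y' m) := by
    intro z z' h h' m hm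
    have h1 := (hYM z h).2 m hm
    have h2 := (hYM z' h').2 m hm
    tauto
  -- the row determines `w` among the in-neighbours of `z`
  have hU : ∀ z, E z a → ∀ w₁ w₂, E w₁ z → E w₂ z → row w₁ = row w₂ → w₁ = w₂ := by
    intro z hz w₁ w₂ h1 h2 hr
    by_contra hne
    have hzc : ConnSet (UG E) (insert z M) := hMc.insert_adj haM (adjr hz)
    have hall : ∀ v₁ v₂, E v₁ z → E v₂ z → row v₁ = row v₂ := by
      intro v₁ v₂ hv1 hv2
      by_cases hv : v₁ = v₂
      · rw [hv]
      have hnM : ∀ v, E v z → v ∉ insert z M := by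
        rintro v hv (rfl | h)
        · exact irr _ hv
        · exact (hWM v z hz hv).1 h
      have hrel : ∀ v v', E v z → E v' z → ∀ m ∈ insert z M,
          (E m v ↔ E m v') ∧ (E v m ↔ E v' m) := by
        rintro v v' h h' m (rfl | hm)
        · simp [h, h', asym _ _ h, asym _ _ h']
        · simp [(hWM v z hz h).2 m hm, (hWM v' z hz h').2 m hm]
      obtain ⟨g, hg, hgM, rfl, rfl⟩ := A.hom.move_two irr (hMf.insert z) (hnM _ h1) (hnM _ hv1)
        (hnM _ h2) (hnM _ hv2) (hrel _ _ h1 hv1) (hrel _ _ h2 hv2) hne hv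
        (by simp [hWW z _ _ h1 h2, hWW z _ _ hv1 hv2])
        (by simp [hWW z _ _ h2 h1, hWW z _ _ hv2 hv1])
        ((hzc.insert_adj (mem_insert _ _) (adjr h1)).insert_adj (Or.inr (mem_insert _ _)) (adjr h2))
      ext y
      have e1 := hrowmap g hg (fun m hm => hgM m (Or.inr hm)) w₁ (g.symm y)
      have e2 := hrowmap g hg (fun m hm => hgM m (Or.inr hm)) w₂ (g.symm y)
      rw [Equiv.apply_symm_apply] at e1 e2
      rw [← e1, ← e2, hr]
    obtain ⟨-, ⟨y, hy, hyQ⟩, y', hy', hyQ'⟩ := hrow w₁ z h1 hz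
    have hnM : ∀ y, E b y → y ∉ insert z M := by
      rintro y hy (rfl | h)
      · exact (hZY _ _ hz hy).1 rfl
      · exact (hYM y hy).1 h
    obtain ⟨g, hg, hgM, rfl⟩ := A.hom.move_one irr (hMf.insert z) (hnM y hy) (hnM y' hy')
      (by
        rintro m (rfl | hm)
        · simp [(hZY _ _ hz hy).2, (hZY _ _ hz hy').2]
        · exact hrelY y y' hy hy' m hm)
      (hzc.insert_adj (Or.inr hbM) (adjl hy))
    have e1 := (hrowmap g hg (fun m hm => hgM m (Or.inr hm)) w₁ y).1 ⟨hy, hyQ⟩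
    have h3 : E (g w₁) z := by rw [← hgM z (mem_insert _ _), hg]; exact h1
    rw [← hall w₁ (g w₁) h1 h3] at e1
    exact hyQ' e1.2
  -- transitivity on triples
  have hT : ∀ z₁ z₂ w z₁' z₂' w', E z₁ a → E z₂ a → z₁ ≠ z₂ → E w z₁ → E z₁' a → E z₂' a →
      z₁' ≠ z₂' → E w' z₁' → ∃ g : Equiv.Perm V, IsAut E g ∧ g z₁ = z₁' ∧ g z₂ = z₂' ∧ g w = w' := by
    intro z₁ z₂ w z₁' z₂' w' hz₁ hz₂ hz hw hz₁' hz₂' hz' hw'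
    obtain ⟨h, hh, hhM, e1, e2⟩ := A.hom.move_two irr hMf (hZM _ hz₁).1 (hZM _ hz₁').1
      (hWM w z₁ hz₁ hw).1 (hWM w' z₁' hz₁' hw').1 (hrelZ _ _ hz₁ hz₁')
      (fun m hm => by simp [(hWM w z₁ hz₁ hw).2 m hm, (hWM w' z₁' hz₁' hw').2 m hm])
      (hWZ w z₁ z₁ hz₁ hw hz₁).symm (hWZ w' z₁' z₁' hz₁' hw' hz₁').symm
      (by simp [asym _ _ hw, asym _ _ hw']) (by simp [hw, hw'])
      ((hMc.insert_adj haM (adjr hz₁)).insert_adj (mem_insert _ _) (adjr hw))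
    have hhz : E (h z₂) a := by rw [← hhM a haM, hh]; exact hz₂
    have hhne : h z₂ ≠ z₁' := by
      rw [← e1]; exact fun he => hz (h.injective he).symm
    have hJ : (row w').Finite := (hrow w' z₁' hw' hz₁').1
    have hnM : ∀ z, E z a → z ≠ z₁' → z ∉ insert z₁' M ∪ row w' := by
      rintro z hz hne ((rfl | hm) | hy)
      · exact hne rfl
      · exact (hZM z hz).1 hm
      · exact (hZY z z hz hy.1).1 rfl
    have hc : ConnSet (UG E) (insert z₁' M ∪ row w') := by
      refine (hMc.insert_adj haM (adjr hz₁')).attach subset_union_left ?_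
      rintro y (hy | hy)
      · exact Or.inl hy
      · exact Or.inr (Or.inl ⟨b, Or.inr hbM, adjl hy.1⟩)
    obtain ⟨g, hg, hgM, e3⟩ := A.hom.move_one irr ((hMf.insert z₁').union hJ)
      (hnM _ hhz hhne) (hnM _ hz₂' hz'.symm)
      (by
        rintro m ((rfl | hm) | hy)
        · simp [hZZ _ _ hz₁' hhz, hZZ _ _ hhz hz₁', hZZ _ _ hz₁' hz₂', hZZ _ _ hz₂' hz₁']
        · exact hrelZ _ _ hhz hz₂' m hm
        · simp [(hZY _ _ hhz hy.1).2, (hZY _ _ hz₂' hy.1).2])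
      (hc.insert_adj (Or.inl (Or.inr haM)) (adjr hhz))
    have hgz : g z₁' = z₁' := hgM _ (Or.inl (mem_insert _ _))
    have hgw : g w' = w' := by
      refine hU z₁' hz₁' _ _ (by rw [← hgz, hg]; exact hw') hw' ?_
      exact image_eq_self_of_mapsTo_iff
        (hrowmap g hg (fun m hm => hgM m (Or.inl (Or.inr hm))) w') fun y hy => hgM y (Or.inr hy)
    exact ⟨h.trans g, hh.trans hg, by simp [e1, hgz], by simp [e3], by simp [e2, hgw]⟩
  by_cases hZ : ∃ z z', E z a ∧ E z' a ∧ z ≠ z'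
  swap
  · left
    intro z z' hz hz' hne
    exact absurd ⟨z, z', hz, hz', hne⟩ hZ
  obtain ⟨z, z', hz, hz', hzz⟩ := hZ
  obtain ⟨w, hw⟩ := A.inn z
  by_cases h1 : E w z'
  · left
    intro x x' hx hx' hne v hv
    obtain ⟨g, hg, -, rfl, rfl⟩ := hT z z' w x x' v hz hz' hzz hw hx hx' hne hv
    exact (hg _ _).2 h1
  by_cases h2 : E z' w
  · right
    refine ⟨⟨z, z', hz, hz', hzz⟩, ?_⟩
    intro x x' hx hx' hne v hv
    obtain ⟨g, hg, -, rfl, rfl⟩ := hT z z' w x x' v hz hz' hzz hw hx hx' hne hv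
    exact (hg _ _).2 h2
  exfalso
  have hnone : ∀ x x' v, E x a → E x' a → x ≠ x' → E v x → ¬ E v x' ∧ ¬ E x' v := by
    intro x x' v hx hx' hne hv
    obtain ⟨g, hg, -, rfl, rfl⟩ := hT z z' w x x' v hz hz' hzz hw hx hx' hne hv
    rw [hg, hg]; exact ⟨h1, h2⟩
  obtain ⟨hIf, ⟨y, hy, hyQ⟩, y', hy', hyQ'⟩ := hrow w z hw hz
  have hI : ∀ x, x ∈ row w → E b x := fun x hx => hx.1
  -- swap `z` and `z'` fixing `M` and the row of `w`
  have hc1 : ConnSet (UG E) (insert z' (insert z (M ∪ row w))) := by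
    refine hMc.attach (fun m hm => Or.inr (Or.inr (Or.inl hm))) ?_
    rintro x (rfl | rfl | hx | hx)
    · exact Or.inr (Or.inl ⟨a, haM, adjr hz'⟩)
    · exact Or.inr (Or.inl ⟨a, haM, adjr hz⟩)
    · exact Or.inl hx
    · exact Or.inr (Or.inl ⟨b, hbM, adjl hx.1⟩)
  have hnM1 : ∀ z, E z a → z ∉ M ∪ row w := by
    rintro x hx (h | h)
    · exact (hZM x hx).1 h
    · exact (hZY x x hx h.1).1 rfl
  have hrel1 : ∀ x x', E x a → E x' a → ∀ m ∈ M ∪ row w,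
      (E m x ↔ E m x') ∧ (E x m ↔ E x' m) := by
    rintro x x' hx hx' m (hm | hm)
    · exact hrelZ x x' hx hx' m hm
    · simp [(hZY x m hx hm.1).2, (hZY x' m hx' hm.1).2]
  obtain ⟨g₁, hg₁, hg₁M, e1, e2⟩ := A.hom.move_two irr (hMf.union hIf) (hnM1 z hz) (hnM1 z' hz')
    (hnM1 z' hz') (hnM1 z hz) (hrel1 z z' hz hz') (hrel1 z' z hz' hz) hzz hzz.symm
    (by simp [hZZ _ _ hz hz', hZZ _ _ hz' hz]) (by simp [hZZ _ _ hz hz', hZZ _ _ hz' hz]) hc1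
  have hg₁M' : ∀ m ∈ M, g₁ m = m := fun m hm => hg₁M m (Or.inl hm)
  have hw1 : E (g₁ w) z' := by rw [← e1, hg₁]; exact hw
  have hrow1 : row (g₁ w) = row w :=
    image_eq_self_of_mapsTo_iff (hrowmap g₁ hg₁ hg₁M' w) fun y hy => hg₁M y (Or.inr hy)
  have hback1 : g₁ (g₁ w) = w := by
    refine hU z hz _ _ (by rw [← e2, hg₁]; exact hw1) hw ?_
    rw [← hrow1]
    exact image_eq_self_of_mapsTo_iff (hrowmap g₁ hg₁ hg₁M' (g₁ w))
      fun y hy => hg₁M y (Or.inr (by rw [hrow1] at hy; exact hy))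
  -- swap `z, z'` and `y, y'` fixing `M` and the rest of the row of `w`
  obtain ⟨g₂, hg₂, hg₂P⟩ := A.hom.extend
    (P := insert (y', y) (insert (y, y') (insert (z', z) (insert (z, z')
      (diagOn (M ∪ (row w \ {y})))))))
    (by
      have hyy : y ≠ y' := by rintro rfl; exact hyQ' hyQ
      refine PIso.insert irr (PIso.insert irr (PIso.insert irr (PIso.insert irr
        (PIso.diagOn _ _) ?_) ?_) ?_) ?_
      · rintro _ ⟨m, hm, rfl⟩
        have hm' : m ∈ M ∪ row w := hm.imp id fun h => h.1
        refine ⟨⟨?_, ?_⟩, hrel1 z z' hz hz' m hm'⟩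
        · rintro rfl; exact absurd hm' (hnM1 _ hz)
        · rintro rfl; exact absurd hm' (hnM1 _ hz')
      · rintro _ (rfl | ⟨m, hm, rfl⟩)
        · simp [hzz, hzz.symm, hZZ _ _ hz hz', hZZ _ _ hz' hz]
        · have hm' : m ∈ M ∪ row w := hm.imp id fun h => h.1
          refine ⟨⟨?_, ?_⟩, hrel1 z' z hz' hz m hm'⟩
          · rintro rfl; exact absurd hm' (hnM1 _ hz')
          · rintro rfl; exact absurd hm' (hnM1 _ hz)
      · rintro _ (rfl | rfl | ⟨m, hm, rfl⟩)
        · simp [hZY _ _ hz hy', hZY _ _ hz' hy]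
        · simp [hZY _ _ hz hy, hZY _ _ hz' hy']
        · rcases hm with hm | ⟨hm, hmy⟩
          · refine ⟨⟨?_, ?_⟩, hrelY y y' hy hy' m hm⟩
            · rintro rfl; exact absurd hm (hYM _ hy).1
            · rintro rfl; exact absurd hm (hYM _ hy').1
          · refine ⟨⟨?_, ?_⟩, by simp [hYY _ _ hm.1 hy, hYY _ _ hm.1 hy'],
              by simp [hYY _ _ hy hm.1, hYY _ _ hy' hm.1]⟩
            · rintro rfl; exact absurd rfl hmy
            · rintro rfl; exact absurd hm.2 hyQ'
      · rintro _ (rfl | rfl | rfl | ⟨m, hm, rfl⟩)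
        · simp [hyy, hyy.symm, hYY _ _ hy hy', hYY _ _ hy' hy]
        · simp [hZY _ _ hz hy, hZY _ _ hz' hy']
        · simp [hZY _ _ hz hy', hZY _ _ hz' hy]
        · rcases hm with hm | ⟨hm, hmy⟩
          · refine ⟨⟨?_, ?_⟩, hrelY y' y hy' hy m hm⟩
            · rintro rfl; exact absurd hm (hYM _ hy').1
            · rintro rfl; exact absurd hm (hYM _ hy).1
          · refine ⟨⟨?_, ?_⟩, by simp [hYY _ _ hm.1 hy, hYY _ _ hm.1 hy'],
              by simp [hYY _ _ hy hm.1, hYY _ _ hy' hm.1]⟩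
            · rintro rfl; exact absurd hm.2 hyQ'
            · rintro rfl; exact absurd rfl hmy)
    (((((((hMf.union hIf.sdiff).image _).insert _).insert _).insert _).insert _))
    (by
      simp only [image_insert_eq, fst_diagOn]
      refine hMc.attach (fun m hm => Or.inr (Or.inr (Or.inr (Or.inr (Or.inl hm))))) ?_
      rintro x (rfl | rfl | rfl | rfl | hx | hx)
      · exact Or.inr (Or.inl ⟨b, hbM, adjl hy'⟩)
      · exact Or.inr (Or.inl ⟨b, hbM, adjl hy⟩)
      · exact Or.inr (Or.inl ⟨a, haM, adjr hz'⟩)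
      · exact Or.inr (Or.inl ⟨a, haM, adjr hz⟩)
      · exact Or.inl hx
      · exact Or.inr (Or.inl ⟨b, hbM, adjl hx.1.1⟩))
  have f1 : g₂ y' = y := hg₂P (y', y) (by simp)
  have f2 : g₂ y = y' := hg₂P (y, y') (by simp)
  have f3 : g₂ z' = z := hg₂P (z', z) (by simp)
  have f4 : g₂ z = z' := hg₂P (z, z') (by simp)
  have f5 : ∀ m ∈ M ∪ (row w \ {y}), g₂ m = m := fun m hm => hg₂P (m, m)
    (Or.inr (Or.inr (Or.inr (Or.inr ⟨m, hm, rfl⟩))))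
  have hg₂M : ∀ m ∈ M, g₂ m = m := fun m hm => f5 m (Or.inl hm)
  have hw2 : E (g₂ w) z' := by rw [← f4, hg₂]; exact hw
  have hy2 : y ∉ row (g₂ w) := by
    intro h
    rw [← f1, ← hrowmap g₂ hg₂ hg₂M] at h
    exact hyQ' h.2
  have hback2 : g₂ (g₂ w) = w := by
    refine hU z hz _ _ (by rw [← f3, hg₂]; exact hw2) hw ?_
    have hsq := hrowmap (g₂.trans g₂) (hg₂.trans hg₂) (fun m hm => by simp [hg₂M m hm]) w
    refine image_eq_self_of_mapsTo_iff hsq fun x hx => ?_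
    by_cases hxy : x = y
    · subst hxy; simp [f1, f2]
    · simp [f5 x (Or.inr ⟨hx, hxy⟩)]
  have hsw : ∀ g : Equiv.Perm V, IsAut E g → g (g w) = w → ¬ E w (g w) ∧ ¬ E (g w) w := by
    intro g hg hb
    constructor
    · intro h
      have := (hg _ _).2 h
      rw [hb] at this
      exact asym _ _ h this
    · intro h
      have := (hg _ _).2 h
      rw [hb] at this
      exact asym _ _ h this
  -- move `g₁ w` to `g₂ w` fixing `M, z, z', w`
  let N : Set V := insert w (insert z' (insert z M))
  have hNr : ∀ v, E v z' → w ≠ v → v ∉ N := by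
    rintro v hv hne (rfl | rfl | rfl | h)
    · exact hne rfl
    · exact irr _ hv
    · exact hWZ _ _ _ hz' hv hz rfl
    · exact (hWM v z' hz' hv).1 h
  have hne1 : ∀ v, E v z' → w ≠ v := by
    rintro v hv rfl
    exact h1 hv
  obtain ⟨g, hg, hgN, e⟩ := A.hom.move_one irr (M := N) (((hMf.insert _).insert _).insert _)
    (hNr _ hw1 (hne1 _ hw1)) (hNr _ hw2 (hne1 _ hw2)) (by
      rintro m (rfl | rfl | rfl | hm)
      · simp [hsw _ hg₁ hback1, hsw _ hg₂ hback2]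
      · simp [hw1, hw2, asym _ _ hw1, asym _ _ hw2]
      · simp [hnone _ _ _ hz' hz hzz.symm hw1, hnone _ _ _ hz' hz hzz.symm hw2]
      · simp [(hWM _ _ hz' hw1).2 m hm, (hWM _ _ hz' hw2).2 m hm])
    ((((hMc.insert_adj haM (adjr hz)).insert_adj (Or.inr haM) (adjr hz')).insert_adj
      (Or.inr (mem_insert _ _)) (adjr hw)).insert_adj (Or.inr (mem_insert _ _)) (adjr hw1))
  have hgM : ∀ m ∈ M, g m = m := fun m hm => hgN m (Or.inr (Or.inr (Or.inr hm)))
  have hgw : g w = w := hgN w (mem_insert _ _)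
  have k1 := hrowmap g hg hgM w (g.symm y)
  have k2 := hrowmap g hg hgM (g₁ w) (g.symm y)
  rw [Equiv.apply_symm_apply] at k1 k2
  rw [hgw] at k1
  rw [e, hrow1, k1] at k2
  exact hy2 (k2.1 ⟨hy, hyQ⟩)

end ArcData

/-- Some but not all directed walks of length `k + 3` have their end vertices related by `Q`,
which is `E` or its reverse. -/
structure ChordData {V : Type u} (E Q : V → V → Prop) (k : ℕ) : Prop extends ArcData E k where
  dir : Q = E ∨ Q = flip E
  yes : ∃ p, DWalk E (k + 3) p ∧ Q (p 0) (p (k + 3))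
  no : ∃ p, DWalk E (k + 3) p ∧ ¬ Q (p 0) (p (k + 3))

section Chord

variable {V : Type u} {E Q : V → V → Prop} {k : ℕ}

theorem ChordData.flip (C : ChordData E Q k) : ChordData (flip E) (flip Q) k where
  toArcData := C.toArcData.flip
  dir := by
    rcases C.dir with rfl | rfl
    · exact Or.inl rfl
    · exact Or.inr rfl
  yes := by
    obtain ⟨p, hp, h⟩ := C.yes
    exact ⟨_, hp.reverse, by simpa [_root_.flip] using h⟩
  no := by
    obtain ⟨p, hp, h⟩ := C.no
    exact ⟨_, hp.reverse, by simpa [_root_.flip] using h⟩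

theorem ChordData.aut (C : ChordData E Q k) {ψ : Equiv.Perm V} (hψ : IsAut E ψ) (x y : V) :
    Q (ψ x) (ψ y) ↔ Q x y := by
  rcases C.dir with h | h
  · rw [h]; exact hψ x y
  · rw [h]; exact hψ y x

theorem ChordData.rows (C : ChordData E Q k) {p : ℕ → V} (hp : DWalk E (k + 2) p) :
    {y | E (p (k + 2)) y ∧ Q (p 0) y}.Finite ∧ (∃ y, E (p (k + 2)) y ∧ Q (p 0) y) ∧
      ∃ y, E (p (k + 2)) y ∧ ¬ Q (p 0) y := by
  refine ⟨(C.row_finite hp).subset ?_, ?_, ?_⟩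
  · rintro y ⟨h1, h2⟩
    refine ⟨h1, (UG_adj_iff C.dig).2 ?_⟩
    rcases C.dir with h | h
    · rw [h] at h2; exact Or.inl h2
    · rw [h] at h2; exact Or.inr h2
  · obtain ⟨r, hr, h⟩ := C.yes
    obtain ⟨ψ, hψ, h1⟩ := C.walk_transitive (by omega) (hr.mono (show k + 2 ≤ k + 3 by omega)) hp
    refine ⟨ψ (r (k + 3)), ?_, ?_⟩
    · rw [← h1 _ le_rfl, hψ]; exact hr (k + 2) (by omega)
    · rw [← h1 0 (by omega), C.aut hψ]; exact h
  · obtain ⟨r, hr, h⟩ := C.no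
    obtain ⟨ψ, hψ, h1⟩ := C.walk_transitive (by omega) (hr.mono (show k + 2 ≤ k + 3 by omega)) hp
    refine ⟨ψ (r (k + 3)), ?_, ?_⟩
    · rw [← h1 _ le_rfl, hψ]; exact hr (k + 2) (by omega)
    · rw [← h1 0 (by omega), C.aut hψ]; exact h

theorem ChordData.shares_or_reverses (C : ChordData E Q k) (a : V) :
    SharesIn E a ∨ ReversesIn E a := by
  obtain ⟨q, rfl, hq⟩ := exists_dWalk C.out a
  exact C.sharesIn_or_reversesIn (fun ψ hψ => C.aut hψ) (hq k) fun w z hwz hz =>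
    C.rows (((hq k).prepend hz).prepend hwz)

theorem ChordData.of_reversesIn (C : ChordData E Q k) {a : V} (h : ReversesIn E a) :
    (∃ b, ReversesIn (_root_.flip E) b) ∧ {y | E y a}.Finite ∧
      ({y | E a y}.Finite → {y | E y a}.ncard < {y | E a y}.ncard) := by
  obtain ⟨⟨z₁, z₂, h1, h2, hne⟩, h⟩ := h
  obtain ⟨w, hw⟩ := C.inn z₁
  have hz₂w : E z₂ w := h z₁ z₂ h1 h2 hne w hw
  have hp : DWalk E 2 (prependSeq w (prependSeq z₁ fun _ => a)) :=
    DWalk.prepend (DWalk.prepend (fun i hi => absurd hi (by omega)) h1) hw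
  have hk : k = 0 := by
    by_contra hk
    have := C.ind 3 (by omega) _ (hp.prepend (w := z₂) hz₂w) 0 3 (by omega) (by omega) h2
    omega
  subst hk
  refine ⟨⟨z₂, ?_⟩, ?_, fun hfin => ?_⟩
  · rcases C.flip.shares_or_reverses z₂ with hS | hR
    · have hwa : w ≠ a := by rintro rfl; exact C.dig.2 _ _ h1 hw
      exact absurd h1 (C.dig.2 _ _ (hS w a hz₂w h2 hwa z₁ hw))
    · exact hR
  · refine ((C.col_finite hp).insert z₁).subset ?_
    intro x hx
    by_cases hxz : x = z₁
    · exact Or.inl hxz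
    · refine Or.inr ⟨h z₁ x h1 hx (Ne.symm hxz) w hw, ?_⟩
      exact (UG_adj_iff C.dig).2 (Or.inr hx)
  · rw [C.in_ncard a z₂, C.out_ncard a z₁]
    refine ncard_lt_ncard ?_ (C.out_finite hfin _)
    refine ⟨fun x hx => h z₂ z₁ h2 h1 hne.symm x hx, fun hsub => ?_⟩
    exact C.dig.2 _ _ h2 (hsub h1)

theorem ChordData.false (C : ChordData E Q k) : False := by
  have key : ∀ {E Q : V → V → Prop}, ChordData E Q k → ∀ a, ¬ ReversesIn E a := by
    intro E Q C a ha
    obtain ⟨⟨b, hb⟩, hf, hlt⟩ := C.of_reversesIn ha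
    obtain ⟨-, hf', hlt'⟩ := C.flip.of_reversesIn hb
    have hof : {y | E a y}.Finite := C.out_finite hf' a
    have l1 := hlt hof
    have l2 := hlt' (C.in_finite hf b)
    change {y | E b y}.ncard < {y | E y b}.ncard at l2
    rw [C.in_ncard b a, C.out_ncard b a] at l2
    omega
  have hin : ∀ a, SharesIn E a := fun a =>
    (C.shares_or_reverses a).resolve_right (key C a)
  have hout : ∀ a, SharesIn (_root_.flip E) a := fun a =>
    (C.flip.shares_or_reverses a).resolve_right (key C.flip a)
  obtain ⟨p, hp, h⟩ := C.yes
  obtain ⟨r, hr, hn⟩ := C.no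
  obtain ⟨ψ, hψ, h1⟩ := C.walk_transitive (by omega) (hp.mono (show k + 2 ≤ k + 3 by omega))
    (hr.mono (by omega))
  have e1 : E (r (k + 2)) (ψ (p (k + 3))) := by
    rw [← h1 _ le_rfl, hψ]; exact hp (k + 2) (by omega)
  have e2 : E (r (k + 2)) (r (k + 3)) := hr (k + 2) (by omega)
  rw [← C.aut hψ, h1 0 (by omega)] at h
  have hne : ψ (p (k + 3)) ≠ r (k + 3) := fun he => hn (he ▸ h)
  rcases C.dir with hQ | hQ
  · rw [hQ] at h hn
    obtain ⟨t, ht⟩ := C.out (ψ (p (k + 3)))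
    exact hn (hin t _ _ ht (hout _ _ _ e1 e2 hne t ht) hne _ h)
  · rw [hQ] at h hn
    exact hn (hout _ _ _ e1 e2 hne _ h)

theorem ArcData.no_chord (A : ArcData E k) {p : ℕ → V} (hp : DWalk E (k + 3) p)
    {i j : ℕ} (hi : i ≤ k + 3) (hj : j ≤ k + 3) (h : E (p i) (p j)) : j = i + 1 := by
  rcases A.chord hp hi hj h with h' | ⟨rfl, rfl⟩ | ⟨rfl, rfl⟩
  · exact h'
  · by_cases hall : ∀ p, DWalk E (k + 3) p → E (p 0) (p (k + 3))
    · refine (A.not_all_forward hall (p 1) ?_).elim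
      refine (A.col_finite (p := fun i => p (i + 1)) (DWalk.shift (d := 1) hp)).subset ?_
      intro x hx
      refine ⟨hx, (UG_adj_iff A.dig).2 (Or.inr ?_)⟩
      exact hall _ (DWalk.prepend (DWalk.shift (m := k + 2) (d := 1) hp) hx)
    · push Not at hall
      exact (ChordData.false (Q := E) ⟨A, Or.inl rfl, ⟨p, hp, h⟩, hall⟩).elim
  · by_cases hall : ∀ p, DWalk E (k + 3) p → E (p (k + 3)) (p 0)
    · refine (A.not_all_backward hall (p (k + 2)) ?_).elim
      refine (A.row_finite (hp.mono (by omega))).subset ?_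
      intro x hx
      refine ⟨hx, (UG_adj_iff A.dig).2 (Or.inr ?_)⟩
      have := hall _ (DWalk.snoc (hp.mono (show k + 2 ≤ k + 3 by omega)) hx)
      simpa using this
    · push Not at hall
      exact (ChordData.false (Q := _root_.flip E) ⟨A, Or.inr rfl, ⟨p, hp, h⟩, hall⟩).elim

/-- A directed walk of length `m` that is not an induced path. -/
def HasChord (E : V → V → Prop) (m : ℕ) : Prop :=
  ∃ p, DWalk E m p ∧ ∃ i j, i ≤ m ∧ j ≤ m ∧ E (p i) (p j) ∧ j ≠ i + 1

theorem dWalk_inj_of_not_hasChord {N : ℕ} (hN : ∀ m < N, ¬ HasChord E m) (m : ℕ) (hm : m ≤ N)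
    (p : ℕ → V) (hp : DWalk E m p) (i j : ℕ) (hi : i ≤ m) (hj : j ≤ m) (hij : p i = p j) :
    i = j := by
  induction m generalizing p i j with
  | zero => omega
  | succ m ih =>
    by_cases h1 : i ≤ m ∧ j ≤ m
    · exact ih (by omega) p (hp.mono (by omega)) i j h1.1 h1.2 hij
    by_cases h2 : 0 < i ∧ 0 < j
    · have := ih (by omega) _ hp.shift (i - 1) (j - 1) (by omega) (by omega)
        (by simpa [Nat.sub_add_cancel h2.1, Nat.sub_add_cancel h2.2] using hij)
      omega
    · by_contra hne
      refine hN m (by omega) ⟨p, hp.mono (by omega), m, 0, le_rfl, by omega, ?_, by omega⟩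
      have := hp m (by omega)
      have h3 : p (m + 1) = p 0 := by
        rcases Nat.lt_or_ge i j with h | h
        · rw [show j = m + 1 by omega, show i = 0 by omega] at hij; exact hij.symm
        · rw [show i = m + 1 by omega, show j = 0 by omega] at hij; exact hij
      rwa [h3] at this

theorem not_hasChord_two (hD : IsDigraph E) (htri : ¬ HasTriangle E) (m : ℕ) (hm : m < 3) :
    ¬ HasChord E m := by
  rintro ⟨p, hp, i, j, hi, hj, h, hne⟩
  have adj : ∀ {x y}, E x y → (UG E).Adj x y := fun h => (UG_adj_iff hD).2 (Or.inl h)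
  have hij : i ≠ j := by rintro rfl; exact hD.1 _ h
  by_cases hji : i = j + 1
  · subst hji
    exact hD.2 _ _ h (hp j (by omega))
  have h2 : m = 2 := by omega
  subst h2
  have a1 := adj (hp 0 (by omega))
  have a2 := adj (hp 1 (by omega))
  have a3 : (UG E).Adj (p 0) (p 2) := by
    obtain ⟨rfl, rfl⟩ | ⟨rfl, rfl⟩ : (i = 0 ∧ j = 2) ∨ (i = 2 ∧ j = 0) := by omega
    · exact adj h
    · exact (adj h).symm
  exact htri ⟨_, _, _, a1, a2, a3⟩

theorem highlyArcTransitive_of_not_hasTriangle [Infinite V] (hD : IsDigraph E)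
    (hhom : DigraphCHom E) (hconn : (UG E).Connected) (htri : ¬ HasTriangle E)
    (hsep : ∃ S : Set V, S.Finite ∧ ∃ u v, u ∉ S ∧ v ∉ S ∧ ¬ ConnOff (UG E) S u v) :
    HighlyArcTransitive E := by
  have hio := exists_in_out hconn hD hhom
  have mk : ∀ k, (∀ m < k + 3, ¬ HasChord E m) → ArcData E k := fun k hk =>
    { dig := hD
      hom := hhom
      conn := hconn
      inf := inferInstance
      tri := htri
      ind := fun m hm p hp i j hi hj h => by
        by_contra hne
        exact hk m hm ⟨p, hp, i, j, hi, hj, h, hne⟩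
      inj := fun m hm p hp => dWalk_inj_of_not_hasChord hk m hm p hp
      inn := hio.1
      out := hio.2
      sep := hsep }
  have hno : ∀ m, ¬ HasChord E m := by
    intro m
    induction m using Nat.strong_induction_on with
    | _ m ih =>
      rcases Nat.lt_or_ge m 3 with hm | hm
      · exact not_hasChord_two hD htri m hm
      · obtain ⟨k, rfl⟩ := Nat.exists_eq_add_of_le' hm
        rintro ⟨p, hp, i, j, hi, hj, h, hne⟩
        exact hne ((mk k ih).no_chord hp hi hj h)
  intro n p q hp hq
  exact (mk n fun m _ => hno m).walk_transitive (by omega) hp.2 hq.2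

end Chord

/-- The component of `u` in `G - S` contains a ray. -/
def Big {V : Type u} (G : SimpleGraph V) (S : Set V) (u : V) : Prop :=
  ∃ r, IsRay G r ∧ (∀ n, r n ∉ S) ∧ ConnOff G S u (r 0)

/-- `S` separates two rays. -/
def SepRays {V : Type u} (G : SimpleGraph V) (S : Set V) : Prop :=
  ∃ u v, Big G S u ∧ Big G S v ∧ ¬ ConnOff G S u v

/-- A finite set of minimum size among those that separate two rays. -/
structure MinCut {V : Type u} (G : SimpleGraph V) (S : Set V) : Prop where
  fin : S.Finite
  sep : SepRays G S
  le : ∀ T : Set V, T.Finite → SepRays G T → S.ncard ≤ T.ncard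

/-- Every component of `G - R` containing a ray meets `X`. -/
def Crosses {V : Type u} (G : SimpleGraph V) (R X : Set V) : Prop :=
  ∀ u, Big G R u → ∃ x ∈ X, ConnOff G R u x

/-- `X` meets two components of `G - R`. -/
def Splits {V : Type u} (G : SimpleGraph V) (R X : Set V) : Prop :=
  ∃ x ∈ X, ∃ y ∈ X, x ∉ R ∧ y ∉ R ∧ ¬ ConnOff G R x y

/-- `A` and `B` partition the complement of `S`, there are no edges between them, and both
contain a component with a ray. -/
structure Sides {V : Type u} (G : SimpleGraph V) (S A B : Set V) : Prop where
  cover : ∀ x, x ∈ A ∨ x ∈ B ∨ x ∈ S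
  disj : ∀ x ∈ A, x ∉ B
  left : ∀ x ∈ A, x ∉ S
  right : ∀ x ∈ B, x ∉ S
  noEdge : ∀ x ∈ A, ∀ y ∈ B, ¬ G.Adj x y
  bigL : ∃ u ∈ A, Big G S u
  bigR : ∃ u ∈ B, Big G S u

section Cuts

variable {V : Type u} {G : SimpleGraph V} {S T R A B A' B' : Set V}

theorem Big.not_mem {u : V} (h : Big G S u) : u ∉ S := by
  obtain ⟨r, -, -, h⟩ := h
  exact h.1

theorem Big.of_connOff {u v : V} (h : Big G S u) (huv : ConnOff G S u v) : Big G S v := by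
  obtain ⟨r, h1, h2, h3⟩ := h
  exact ⟨r, h1, h2, huv.symm.trans h3⟩

theorem Big.exists_ray {u : V} (h : Big G S u) :
    ∃ r, IsRay G r ∧ ∀ n, ConnOff G S u (r n) := by
  obtain ⟨r, h1, h2, h3⟩ := h
  exact ⟨r, h1, fun n => h3.trans (h1.connOff h2 n)⟩

theorem IsRay.big {r : ℕ → V} (hr : IsRay G r) (h : ∀ n, r n ∉ S) : Big G S (r 0) :=
  ⟨r, hr, h, .refl (h 0)⟩

theorem Big.anti {u : V} (h : Big G S u) (hTS : T ⊆ S) : Big G T u := by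
  obtain ⟨r, h1, h2, h3⟩ := h
  exact ⟨r, h1, fun n hn => h2 n (hTS hn), h3.anti hTS⟩

theorem SepRays.exists_other (h : SepRays G S) (u : V) : ∃ v, Big G S v ∧ ¬ ConnOff G S u v := by
  obtain ⟨a, b, ha, hb, hn⟩ := h
  by_cases h1 : ConnOff G S u a
  · exact ⟨b, hb, fun h2 => hn (h1.symm.trans h2)⟩
  · exact ⟨a, ha, h1⟩

theorem MinCut.full (hS : MinCut G S) {u s : V} (hu : Big G S u) (hs : s ∈ S) :
    ∃ a, G.Adj s a ∧ ConnOff G S u a := by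
  obtain ⟨v, hv, hn⟩ := hS.sep.exists_other u
  by_contra hne
  have h1 : ¬ ConnOff G (S \ {s}) u v := fun h =>
    hne (exists_adj_of_connOff_diff hu.not_mem h hn)
  have := hS.le (S \ {s}) hS.fin.sdiff ⟨u, v, hu.anti sdiff_subset, hv.anti sdiff_subset, h1⟩
  have h2 := ncard_sdiff_singleton_lt_of_mem hs hS.fin
  omega

theorem MinCut.splits_of_crosses {X : Set V} (hR : MinCut G R) (h : Crosses G R X) :
    Splits G R X := by
  obtain ⟨u, v, hu, hv, hn⟩ := hR.sep
  obtain ⟨x, hx, h1⟩ := h u hu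
  obtain ⟨y, hy, h2⟩ := h v hv
  exact ⟨x, hx, y, hy, h1.right, h2.right, fun h => hn ((h1.trans h).trans h2.symm)⟩

theorem MinCut.crosses_of_splits (hS : MinCut G S) (h : Splits G R S) : Crosses G S R := by
  obtain ⟨x, hx, y, hy, hxR, hyR, hn⟩ := h
  intro w hw
  by_contra hne
  push Not at hne
  obtain ⟨a, ha, hwa⟩ := hS.full hw hx
  obtain ⟨b, hb, hwb⟩ := hS.full hw hy
  have hav : ∀ z, ConnOff G S w z → z ∉ R := fun z hz hzR => hne z hzR hz
  have h1 := (hwa.change hav)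
  have h2 := (hwb.change hav)
  exact hn (((h1.symm.trans h2).symm.step ha.symm hxR).symm.step hb.symm hyR)

theorem MinCut.splits_symm (hS : MinCut G S) (h : Splits G R S) : Splits G S R :=
  hS.splits_of_crosses (hS.crosses_of_splits h)

theorem MinCut.crosses_iff_splits (hS : MinCut G S) (hR : MinCut G R) :
    Crosses G R S ↔ Splits G R S :=
  ⟨hR.splits_of_crosses, fun h => hR.crosses_of_splits (hS.splits_symm h)⟩

/-- Connected vertices are joined by a finite connected set. -/
theorem ConnOff.exists_finite {u v : V} (h : ConnOff G S u v) :
    ∃ L : Set V, L.Finite ∧ ConnSet G L ∧ u ∈ L ∧ v ∈ L ∧ Disjoint L S := by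
  refine h.induction_mem
    (P := fun v => ∃ L : Set V, L.Finite ∧ ConnSet G L ∧ u ∈ L ∧ v ∈ L ∧ Disjoint L S)
    ⟨{u}, finite_singleton u, .singleton u, rfl, rfl, by simpa using h.1⟩ ?_
  rintro a b - ⟨L, hL, hc, hu, ha, hd⟩ hab hb
  refine ⟨insert b L, hL.insert b, hc.insert_adj ha hab, Or.inr hu, mem_insert _ _, ?_⟩
  rw [disjoint_insert_left]
  exact ⟨hb, hd⟩

theorem finite_tight_separators (u v : V) (k j : ℕ) : ∀ P : Set V, P.Finite → P.ncard + j = k →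
    {R : Set V | P ⊆ R ∧ R.Finite ∧ R.ncard = k ∧ ¬ ConnOff G R u v ∧
      ∀ s ∈ R, ConnOff G (R \ {s}) u v}.Finite := by
  induction j with
  | zero =>
    intro P hP hk
    refine (finite_singleton P).subset ?_
    rintro R ⟨hPR, hR, hRk, -⟩
    exact (eq_of_subset_of_ncard_le hPR (by omega) hR).symm
  | succ j ih =>
    intro P hP hk
    by_cases hc : ConnOff G P u v
    · obtain ⟨L, hL, hLc, hu, hv, hd⟩ := hc.exists_finite
      refine (hL.biUnion (t := fun p => {R : Set V | insert p P ⊆ R ∧ R.Finite ∧ R.ncard = k ∧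
        ¬ ConnOff G R u v ∧ ∀ s ∈ R, ConnOff G (R \ {s}) u v}) fun p hp => ?_).subset ?_
      · refine ih (insert p P) (hP.insert p) ?_
        rw [ncard_insert_of_notMem (disjoint_left.1 hd hp) hP]
        omega
      · rintro R ⟨hPR, hR, hRk, hn, ht⟩
        have : ¬ Disjoint L R := fun h => hn (.of_connSet hLc h hu hv)
        obtain ⟨p, hp, hpR⟩ := not_disjoint_iff.1 this
        exact mem_biUnion hp ⟨insert_subset hpR hPR, hR, hRk, hn, ht⟩
    · refine (finite_singleton P).subset ?_
      rintro R ⟨hPR, hR, hRk, -, ht⟩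
      by_contra hne
      obtain ⟨s, hs, hsP⟩ := exists_of_ssubset (hPR.ssubset_of_ne fun h => hne h.symm)
      exact hc ((ht s hs).anti fun x hx => ⟨hPR hx, fun h => hsP (h ▸ hx)⟩)

theorem MinCut.ncard_eq (hS : MinCut G S) (hT : MinCut G T) : S.ncard = T.ncard :=
  le_antisymm (hS.le T hT.fin hT.sep) (hT.le S hS.fin hS.sep)

theorem MinCut.finite_crossing (hS : MinCut G S) : {R | MinCut G R ∧ Crosses G R S}.Finite := by
  refine ((hS.fin.prod hS.fin).biUnion (t := fun p : V × V => {R : Set V | ∅ ⊆ R ∧ R.Finite ∧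
    R.ncard = S.ncard ∧ ¬ ConnOff G R p.1 p.2 ∧ ∀ s ∈ R, ConnOff G (R \ {s}) p.1 p.2})
    fun p _ => finite_tight_separators p.1 p.2 _ S.ncard ∅ finite_empty (by simp)).subset ?_
  rintro R ⟨hR, hc⟩
  obtain ⟨u, v, hu, hv, hn⟩ := hR.sep
  obtain ⟨x, hx, h1⟩ := hc u hu
  obtain ⟨y, hy, h2⟩ := hc v hv
  refine mem_biUnion (show (x, y) ∈ S ×ˢ S from ⟨hx, hy⟩)
    ⟨empty_subset _, hR.fin, hR.ncard_eq hS, fun h => hn ((h1.trans h).trans h2.symm), ?_⟩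
  intro s hs
  obtain ⟨a, ha, h3⟩ := hR.full (hu.of_connOff h1) hs
  obtain ⟨b, hb, h4⟩ := hR.full (hv.of_connOff h2) hs
  have hss : s ∉ R \ {s} := fun h => h.2 rfl
  exact ((h3.anti sdiff_subset).step ha.symm hss).trans
    ((h4.anti sdiff_subset).step hb.symm hss).symm

theorem Sides.symm (h : Sides G S A B) : Sides G S B A where
  cover x := by have := h.cover x; tauto
  disj x hx hx' := h.disj x hx' hx
  left := h.right
  right := h.left
  noEdge x hx y hy hxy := h.noEdge y hy x hx hxy.symm
  bigL := h.bigR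
  bigR := h.bigL

theorem SepRays.exists_sides (h : SepRays G S) : ∃ A B, Sides G S A B := by
  obtain ⟨u, v, hu, hv, hn⟩ := h
  refine ⟨{x | ConnOff G S u x}, {x | x ∉ S ∧ ¬ ConnOff G S u x}, ?_, ?_, ?_, ?_, ?_, ?_, ?_⟩
  · intro x
    by_cases h1 : x ∈ S
    · exact Or.inr (Or.inr h1)
    · by_cases h2 : ConnOff G S u x
      · exact Or.inl h2
      · exact Or.inr (Or.inl ⟨h1, h2⟩)
  · exact fun x hx hx' => hx'.2 hx
  · exact fun x hx => ConnOff.right hx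
  · exact fun x hx => hx.1
  · exact fun x hx y hy hxy => hy.2 (ConnOff.step hx hxy hy.1)
  · exact ⟨u, .refl hu.not_mem, hu⟩
  · exact ⟨v, ⟨hv.not_mem, hn⟩, hv⟩

theorem Sides.mem_left (h : Sides G S A B) {x y : V} (hx : x ∈ A) (hxy : ConnOff G S x y) :
    y ∈ A := by
  refine hxy.induction_mem hx ?_
  intro a b _ ha hab hb
  rcases h.cover b with h1 | h1 | h1
  · exact h1
  · exact absurd hab (h.noEdge a ha b h1)
  · exact absurd h1 hb

theorem Sides.mem_right (h : Sides G S A B) {x y : V} (hx : x ∈ B) (hxy : ConnOff G S x y) :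
    y ∈ B := h.symm.mem_left hx hxy

/-- The quadrant has a ray. -/
def HasRay (G : SimpleGraph V) (X : Set V) : Prop := ∃ r, IsRay G r ∧ ∀ n, r n ∈ X

theorem Sides.quadrant (h : Sides G S A B) (h' : Sides G T A' B') (hT : T.Finite) :
    HasRay G (A ∩ A') ∨ HasRay G (A ∩ B') := by
  obtain ⟨u, hu, hb⟩ := h.bigL
  obtain ⟨r, hr, hur⟩ := hb.exists_ray
  obtain ⟨N, hN⟩ := hr.eventually_not_mem hT
  have h1 : ∀ n, r (n + N) ∈ A := fun n => h.mem_left hu (hur _)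
  have h2 : ∀ n, r (n + N) ∉ T := fun n => hN _ (by omega)
  have h3 := (hr.shift N).connOff h2
  rcases h'.cover (r (0 + N)) with h4 | h4 | h4
  · exact Or.inl ⟨_, hr.shift N, fun n => ⟨h1 n, h'.mem_left h4 (h3 n)⟩⟩
  · exact Or.inr ⟨_, hr.shift N, fun n => ⟨h1 n, h'.mem_right h4 (h3 n)⟩⟩
  · exact absurd h4 (h2 0)

/-- The corner separator between the quadrants `A ∩ A'` and `B ∩ B'`, close to the former. -/
def corner (S A T A' : Set V) : Set V := (S ∩ A') ∪ (S ∩ T) ∪ (T ∩ A)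

theorem corner_finite (hS : S.Finite) (hT : T.Finite) : (corner S A T A').Finite :=
  (hS.union hT).subset (by
    rintro x ((hx | hx) | hx)
    · exact Or.inl hx.1
    · exact Or.inl hx.1
    · exact Or.inr hx.1)

theorem mem_quadrant_of_connOff (h : Sides G S A B) (h' : Sides G T A' B') {x y : V}
    (hx : x ∈ A ∩ A') (hxy : ConnOff G (corner S A T A') x y) : y ∈ A ∩ A' := by
  refine hxy.induction_mem (P := fun y => y ∈ A ∩ A') hx ?_
  intro a b _ ha hab hb
  have h1 := h.noEdge a ha.1 b
  have h2 := h'.noEdge a ha.2 b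
  have h3 := h.cover b
  have h4 := h'.cover b
  simp only [corner, mem_union, mem_inter_iff] at hb ⊢
  tauto

theorem notMem_corner_of_mem_quadrant (h : Sides G S A B) (h' : Sides G T A' B') {x : V}
    (hx : x ∈ A ∩ A') : x ∉ corner S A T A' := by
  have h1 := h.left x hx.1
  have h2 := h'.left x hx.2
  simp only [corner, mem_union, mem_inter_iff]
  tauto

theorem notMem_corner_of_mem_opposite (h : Sides G S A B) (h' : Sides G T A' B') {x : V}
    (hx : x ∈ B ∩ B') : x ∉ corner S A T A' := by
  have h1 := h.right x hx.1
  have h2 := h'.right x hx.2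
  simp only [corner, mem_union, mem_inter_iff]
  tauto

theorem corner_sepRays (h : Sides G S A B) (h' : Sides G T A' B') (h1 : HasRay G (A ∩ A'))
    (h2 : HasRay G (B ∩ B')) : SepRays G (corner S A T A') := by
  obtain ⟨r, hr, hrA⟩ := h1
  obtain ⟨r', hr', hrB⟩ := h2
  refine ⟨_, _, hr.big fun n => notMem_corner_of_mem_quadrant h h' (hrA n),
    hr'.big fun n => notMem_corner_of_mem_opposite h h' (hrB n), fun hc => ?_⟩
  exact h.disj _ (mem_quadrant_of_connOff h h' (hrA 0) hc).1 (hrB 0).1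

theorem corner_ncard (hS : S.Finite) (hT : T.Finite) (h : Sides G S A B) (h' : Sides G T A' B') :
    (corner S A T A').ncard + (corner S B T B').ncard = S.ncard + T.ncard := by
  rw [← ncard_union_add_ncard_inter _ _ (corner_finite hS hT) (corner_finite hS hT),
    ← ncard_union_add_ncard_inter S T hS hT]
  congr 2
  · ext x
    have h1 := h.cover x
    have h2 := h'.cover x
    simp only [corner, mem_union, mem_inter_iff]
    tauto
  · ext x
    have h1 := h.disj x
    have h2 := h'.disj x
    have h3 := h.left x
    have h4 := h'.left x
    have h5 := h.right x
    have h6 := h'.right x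
    simp only [corner, mem_union, mem_inter_iff]
    constructor
    · rintro ⟨(⟨a, b⟩ | h) | ⟨a, b⟩, (⟨c, d⟩ | h) | ⟨c, d⟩⟩ <;> first | assumption | tauto
    · exact fun h => ⟨Or.inl (Or.inr h), Or.inl (Or.inr h)⟩

theorem corner_minCut (hS : MinCut G S) (hT : MinCut G T) (h : Sides G S A B)
    (h' : Sides G T A' B') (h1 : HasRay G (A ∩ A')) (h2 : HasRay G (B ∩ B')) :
    MinCut G (corner S A T A') := by
  have e := corner_ncard hS.fin hT.fin h h'
  have e1 := hS.le _ (corner_finite hS.fin hT.fin) (corner_sepRays h.symm h'.symm h2 h1)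
  have e2 := hS.ncard_eq hT
  refine ⟨corner_finite hS.fin hT.fin, corner_sepRays h h' h1 h2, fun R hR hRs => ?_⟩
  have := hS.le R hR hRs
  omega

theorem crosses_or_of_crosses_corner (hS : MinCut G S) (hT : MinCut G T) (hR : MinCut G R)
    (h : Sides G S A B) (h' : Sides G T A' B') (h1 : HasRay G (A ∩ A')) (h2 : HasRay G (B ∩ B'))
    (hST : Crosses G S T) (hTS : Crosses G T S) (hc : Crosses G R (corner S A T A')) :
    Crosses G R S ∨ Crosses G R T := by
  by_contra hno
  push Not at hno
  obtain ⟨hnS, hnT⟩ := hno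
  have hspl : ¬ Splits G R T := fun hs => hnT ((hT.crosses_iff_splits hR).2 hs)
  unfold Crosses at hnS hnT
  push Not at hnS hnT
  obtain ⟨e, he, heS⟩ := hnS
  obtain ⟨e', he', heT⟩ := hnT
  obtain ⟨p, hp, hep⟩ := hc e he
  obtain ⟨q, hq, heq⟩ := hc e' he'
  have hpT : p ∈ T ∩ A := by
    have := heS p
    simp only [corner, mem_union, mem_inter_iff] at hp ⊢
    tauto
  have hqS : q ∈ S ∩ A' := by
    have := heT q
    simp only [corner, mem_union, mem_inter_iff] at hq ⊢
    tauto
  have hEA : ∀ x, ConnOff G R e x → x ∈ A := fun x hx =>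
    h.mem_left hpT.2 ((hep.symm.trans hx).change fun y hy hyS => heS y hyS (hep.trans hy))
  have hEA' : ∀ x, ConnOff G R e' x → x ∈ A' := fun x hx =>
    h'.mem_left hqS.2 ((heq.symm.trans hx).change fun y hy hyT => heT y hyT (heq.trans hy))
  have hRB : ∀ x ∈ R, x ∉ B := by
    intro x hx hxB
    obtain ⟨a, ha, hea⟩ := hR.full he hx
    exact h.noEdge a (hEA a hea) x hxB ha.symm
  have hRB' : ∀ x ∈ R, x ∉ B' := by
    intro x hx hxB
    obtain ⟨a, ha, hea⟩ := hR.full he' hx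
    exact h'.noEdge a (hEA' a hea) x hxB ha.symm
  obtain ⟨r, hr, hrB⟩ := h2
  have hK := corner_minCut hS hT h.symm h'.symm ⟨r, hr, hrB⟩ h1
  have hbig : Big G (corner S B T B') (r 0) :=
    hr.big fun n => notMem_corner_of_mem_quadrant h.symm h'.symm (hrB n)
  obtain ⟨v, hvB, hv⟩ := h.bigR
  obtain ⟨t, ht, hvt⟩ := hST v hv
  have htB : t ∈ B := h.mem_right hvB hvt
  obtain ⟨v', hvB', hv'⟩ := h'.bigR
  obtain ⟨s, hs, hvs⟩ := hTS v' hv'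
  have hsB' : s ∈ B' := h'.mem_right hvB' hvs
  obtain ⟨a, hta, hra⟩ := hK.full hbig (s := t) (Or.inr ⟨ht, htB⟩)
  obtain ⟨b, hsb, hrb⟩ := hK.full hbig (s := s) (Or.inl (Or.inl ⟨hs, hsB'⟩))
  have hav : ∀ z, ConnOff G (corner S B T B') (r 0) z → z ∉ R := fun z hz hzR =>
    hRB z hzR (mem_quadrant_of_connOff h.symm h'.symm (hrB 0) hz).1
  have htR : t ∉ R := fun hx => hRB t hx htB
  have hsR : s ∉ R := fun hx => hRB' s hx hsB'
  have hts : ConnOff G R t s :=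
    (((hra.change hav).symm.trans (hrb.change hav)).symm.step hta.symm htR).symm.step hsb.symm hsR
  have hpt : ConnOff G R p t := by
    by_contra hn
    exact hspl ⟨p, hpT.1, t, ht, hep.right, htR, hn⟩
  exact heS s hs ((hep.trans hpt).trans hts)

theorem crosses_left_of_crosses_corners (h : Sides G S A B) (hc : Crosses G R (corner S A T A'))
    (hc' : Crosses G R (corner S B T B')) : Crosses G R S := by
  by_contra hn
  unfold Crosses at hn
  push Not at hn
  obtain ⟨e, he, heS⟩ := hn
  obtain ⟨p, hp, hep⟩ := hc e he
  obtain ⟨q, hq, heq⟩ := hc' e he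
  have hpT : p ∈ A := by
    have := heS p
    simp only [corner, mem_union, mem_inter_iff] at hp ⊢
    tauto
  have hqT : q ∈ B := by
    have := heS q
    simp only [corner, mem_union, mem_inter_iff] at hq ⊢
    tauto
  have : q ∈ A := h.mem_left hpT ((hep.symm.trans heq).change fun y hy hyS =>
    heS y hyS (hep.trans hy))
  exact h.disj q this hqT

theorem corner_comm : corner S A T A' = corner T A' S A := by
  ext x
  simp only [corner, mem_union, mem_inter_iff]
  tauto

theorem not_crosses_corner (h : Sides G S A B) : ¬ Crosses G S (corner S A T A') := by
  intro hc
  obtain ⟨v, hvB, hv⟩ := h.bigR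
  obtain ⟨x, hx, hvx⟩ := hc v hv
  have h1 := h.mem_right hvB hvx
  have h2 := h.disj x
  have h3 := h.right x h1
  simp only [corner, mem_union, mem_inter_iff] at hx
  tauto

/-- The set of minimum cuts crossing `S`. -/
def crossing (G : SimpleGraph V) (S : Set V) : Set (Set V) := {R | MinCut G R ∧ Crosses G R S}

theorem exists_smaller_crossing (hS : MinCut G S) (hT : MinCut G T) (hc : Crosses G S T) :
    ∃ K L, MinCut G K ∧ MinCut G L ∧
      (crossing G K).ncard + (crossing G L).ncard < (crossing G S).ncard + (crossing G T).ncard := by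
  have hc' : Crosses G T S := hT.crosses_of_splits (hS.splits_of_crosses hc)
  have main : ∀ {A B A' B' : Set V}, Sides G S A B → Sides G T A' B' → HasRay G (A ∩ A') →
      HasRay G (B ∩ B') → ∃ K L, MinCut G K ∧ MinCut G L ∧
      (crossing G K).ncard + (crossing G L).ncard <
        (crossing G S).ncard + (crossing G T).ncard := by
    intro A B A' B' h h' h1 h2
    have hK := corner_minCut hS hT h h' h1 h2
    have hL := corner_minCut hS hT h.symm h'.symm h2 h1
    refine ⟨_, _, hK, hL, ?_⟩
    rw [← ncard_union_add_ncard_inter (crossing G (corner S A T A')) (crossing G (corner S B T B'))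
      hK.finite_crossing hL.finite_crossing,
      ← ncard_union_add_ncard_inter (crossing G S) (crossing G T) hS.finite_crossing hT.finite_crossing]
    refine add_lt_add_of_lt_of_le (ncard_lt_ncard ?_ (hS.finite_crossing.union hT.finite_crossing))
      (ncard_le_ncard ?_ (hS.finite_crossing.inter_of_left _))
    · refine (ssubset_iff_of_subset ?_).2 ⟨S, Or.inr ⟨hS, hc⟩, ?_⟩
      · rintro R (⟨hR, hRc⟩ | ⟨hR, hRc⟩)
        · exact (crosses_or_of_crosses_corner hS hT hR h h' h1 h2 hc hc' hRc).imp
            (fun x => ⟨hR, x⟩) fun x => ⟨hR, x⟩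
        · exact (crosses_or_of_crosses_corner hS hT hR h.symm h'.symm h2 h1 hc hc' hRc).imp
            (fun x => ⟨hR, x⟩) fun x => ⟨hR, x⟩
      · rintro (⟨-, hx⟩ | ⟨-, hx⟩)
        · exact not_crosses_corner h hx
        · exact not_crosses_corner h.symm hx
    · rintro R ⟨⟨hR, hRc⟩, -, hRc'⟩
      refine ⟨⟨hR, crosses_left_of_crosses_corners h hRc hRc'⟩, hR, ?_⟩
      rw [corner_comm] at hRc hRc'
      exact crosses_left_of_crosses_corners h' hRc hRc'
  obtain ⟨A, B, h⟩ := hS.sep.exists_sides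
  obtain ⟨A', B', h'⟩ := hT.sep.exists_sides
  have q1 := h.quadrant h' hT.fin
  have q2 := h.symm.quadrant h' hT.fin
  have q3 := h'.quadrant h hS.fin
  have q4 := h'.symm.quadrant h hS.fin
  rw [inter_comm A' A, inter_comm A' B] at q3
  rw [inter_comm B' A, inter_comm B' B] at q4
  by_cases hA : HasRay G (A ∩ A') ∧ HasRay G (B ∩ B')
  · exact main h h' hA.1 hA.2
  · refine main h h'.symm ?_ ?_
    · tauto
    · tauto

/-- An automorphism-invariant family of minimum cuts no two of which cross. -/
structure NestedCuts (G : SimpleGraph V) (𝒯 : Set (Set V)) : Prop where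
  nonempty : 𝒯.Nonempty
  cut : ∀ T ∈ 𝒯, MinCut G T
  nested : ∀ T ∈ 𝒯, ∀ T' ∈ 𝒯, ∀ x ∈ T', ∀ y ∈ T', x ∉ T → y ∉ T → ConnOff G T x y
  map : ∀ ψ : Equiv.Perm V, (∀ x y, G.Adj (ψ x) (ψ y) ↔ G.Adj x y) → ∀ T ∈ 𝒯, ψ '' T ∈ 𝒯

theorem ConnOff.map_iff (ψ : Equiv.Perm V) (hψ : ∀ x y, G.Adj (ψ x) (ψ y) ↔ G.Adj x y) {u v : V} :
    ConnOff G (ψ '' S) (ψ u) (ψ v) ↔ ConnOff G S u v := by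
  constructor
  · intro h
    have := h.map (f := ψ.symm) (X := S) (fun x y hxy => by
      rw [← hψ]; simpa using hxy) (fun x hx hxS => hx ((mem_image _ _ _).2 ⟨ψ.symm x, hxS, ψ.apply_symm_apply x⟩))
    simpa using this
  · refine ConnOff.map (fun x y => (hψ x y).2) ?_
    rintro x hx ⟨y, hy, hxy⟩
    exact hx (ψ.injective hxy ▸ hy)

theorem Big.map (ψ : Equiv.Perm V) (hψ : ∀ x y, G.Adj (ψ x) (ψ y) ↔ G.Adj x y) {u : V}
    (h : Big G S u) : Big G (ψ '' S) (ψ u) := by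
  obtain ⟨r, h1, h2, h3⟩ := h
  refine ⟨fun n => ψ (r n), ⟨ψ.injective.comp h1.1, fun n => (hψ _ _).2 (h1.2 n)⟩, ?_,
    (ConnOff.map_iff ψ hψ).2 h3⟩
  rintro n ⟨y, hy, hxy⟩
  exact h2 n (ψ.injective hxy ▸ hy)

theorem MinCut.map (ψ : Equiv.Perm V) (hψ : ∀ x y, G.Adj (ψ x) (ψ y) ↔ G.Adj x y)
    (h : MinCut G S) : MinCut G (ψ '' S) := by
  obtain ⟨u, v, hu, hv, hn⟩ := h.sep
  refine ⟨h.fin.image ψ, ⟨ψ u, ψ v, hu.map ψ hψ, hv.map ψ hψ,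
    fun hc => hn ((ConnOff.map_iff ψ hψ).1 hc)⟩, fun T hT hTs => ?_⟩
  rw [ncard_image_of_injective _ ψ.injective]
  exact h.le T hT hTs

theorem Crosses.map (ψ : Equiv.Perm V) (hψ : ∀ x y, G.Adj (ψ x) (ψ y) ↔ G.Adj x y)
    (h : Crosses G R S) : Crosses G (ψ '' R) (ψ '' S) := by
  intro u hu
  have hψ' : ∀ x y, G.Adj (ψ.symm x) (ψ.symm y) ↔ G.Adj x y := fun x y => by
    rw [← hψ]; simp
  have h1 := hu.map ψ.symm hψ'
  rw [← image_comp] at h1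
  simp only [Equiv.symm_comp_self, image_id] at h1
  obtain ⟨x, hx, hux⟩ := h _ h1
  refine ⟨ψ x, ⟨x, hx, rfl⟩, ?_⟩
  have := (ConnOff.map_iff ψ hψ).2 hux
  simpa using this

theorem crossing_ncard_map (ψ : Equiv.Perm V) (hψ : ∀ x y, G.Adj (ψ x) (ψ y) ↔ G.Adj x y)
    (hS : MinCut G S) : (crossing G (ψ '' S)).ncard ≤ (crossing G S).ncard := by
  have hψ' : ∀ x y, G.Adj (ψ.symm x) (ψ.symm y) ↔ G.Adj x y := fun x y => by
    rw [← hψ]; simp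
  have hfin : (crossing G S).Finite := hS.finite_crossing
  refine (ncard_le_ncard (t := (fun R => ψ '' R) '' crossing G S) ?_ (hfin.image _)).trans
    (ncard_image_le hfin)
  rintro R ⟨hR, hc⟩
  refine ⟨ψ.symm '' R, ⟨hR.map ψ.symm hψ', ?_⟩, ?_⟩
  · have := hc.map ψ.symm hψ'
    rw [← image_comp ψ.symm ψ] at this
    simpa only [Equiv.symm_comp_self, image_id] using this
  · simp only [← image_comp, Equiv.self_comp_symm, image_id]

theorem exists_nestedCuts (hends : MoreThanOneEnd G) : ∃ 𝒯, NestedCuts G 𝒯 := by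
  classical
  have hex : ∃ n, ∃ S : Set V, S.Finite ∧ SepRays G S ∧ S.ncard = n := by
    obtain ⟨S, hS, r, r', hr, hr', h1, h2, hn⟩ := hends.exists_separator
    exact ⟨_, S, hS, ⟨_, _, hr.big h1, hr'.big h2, hn⟩, rfl⟩
  have hcut : ∃ S, MinCut G S := by
    obtain ⟨S, hS, hs, hn⟩ := Nat.find_spec hex
    exact ⟨S, hS, hs, fun T hT hTs => by rw [hn]; exact Nat.find_min' hex ⟨T, hT, hTs, rfl⟩⟩
  have hex2 : ∃ n, ∃ S : Set V, MinCut G S ∧ (crossing G S).ncard = n := by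
    obtain ⟨S, hS⟩ := hcut
    exact ⟨_, S, hS, rfl⟩
  obtain ⟨S₀, hS₀, hn₀⟩ := Nat.find_spec hex2
  refine ⟨{S | MinCut G S ∧ ∀ T, MinCut G T → (crossing G S).ncard ≤ (crossing G T).ncard},
    ⟨S₀, hS₀, fun T hT => by rw [hn₀]; exact Nat.find_min' hex2 ⟨T, hT, rfl⟩⟩,
    fun T hT => hT.1, ?_, ?_⟩
  · intro T hT T' hT' x hx y hy hxT hyT
    by_contra hn
    have hc : Crosses G T' T := hT'.1.crosses_of_splits ⟨x, hx, y, hy, hxT, hyT, hn⟩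
    obtain ⟨K, L, hK, hL, hlt⟩ := exists_smaller_crossing hT'.1 hT.1 hc
    have e1 := hT.2 K hK
    have e2 := hT'.2 L hL
    omega
  · intro ψ hψ T hT
    exact ⟨hT.1.map ψ hψ, fun R hR => (crossing_ncard_map ψ hψ hT.1).trans (hT.2 R hR)⟩

end Cuts

/-- A cut through `s` together with a vertex of a component containing a ray. -/
structure CutAt {V : Type u} (G : SimpleGraph V) (𝒯 : Set (Set V)) (s : V) where
  cut : Set V
  mem : cut ∈ 𝒯
  base : s ∈ cut
  pt : V
  big : Big G cut pt

section Triangles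

variable {V : Type u} {E : V → V → Prop}

theorem HasTriangle.exists_path (hD : IsDigraph E) (h : HasTriangle E) :
    ∃ u v w, E u v ∧ E v w ∧ (UG E).Adj u w := by
  obtain ⟨u, v, w, h1, h2, h3⟩ := h
  have a1 := h1
  have a2 := h2
  have a3 := h3
  simp only [UG_adj_iff hD] at a1 a2 a3
  rcases a1 with a1 | a1 <;> rcases a2 with a2 | a2 <;> rcases a3 with a3 | a3
  all_goals first
    | exact ⟨u, v, w, a1, a2, h3⟩
    | exact ⟨u, w, v, ‹_›, ‹_›, h1⟩
    | exact ⟨v, u, w, ‹_›, ‹_›, h2⟩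
    | exact ⟨v, w, u, ‹_›, ‹_›, h1.symm⟩
    | exact ⟨w, u, v, ‹_›, ‹_›, h2.symm⟩
    | exact ⟨w, v, u, ‹_›, ‹_›, h3.symm⟩

theorem HasTriangle.exists_out (hD : IsDigraph E) (hhom : DigraphCHom E) (h : HasTriangle E)
    {a s : V} (has : E a s) : ∃ b, E s b ∧ (UG E).Adj a b := by
  obtain ⟨u, v, w, h1, h2, h3⟩ := h.exists_path hD
  obtain ⟨ψ, hψ, rfl, rfl⟩ := hhom.edge_transitive hD h1 has
  exact ⟨ψ w, (hψ _ _).2 h2, (hψ.adj _ _).2 h3⟩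

theorem HasTriangle.exists_in (hD : IsDigraph E) (hhom : DigraphCHom E) (h : HasTriangle E)
    {s b : V} (hsb : E s b) : ∃ a, E a s ∧ (UG E).Adj a b := by
  obtain ⟨u, v, w, h1, h2, h3⟩ := h.exists_path hD
  obtain ⟨ψ, hψ, rfl, rfl⟩ := hhom.edge_transitive hD h2 hsb
  exact ⟨ψ u, (hψ _ _).2 h1, (hψ.adj _ _).2 h3⟩

variable {𝒯 : Set (Set V)}

theorem NestedCuts.map_aut (h : NestedCuts (UG E) 𝒯) {ψ : Equiv.Perm V} (hψ : IsAut E ψ)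
    {T : Set V} (hT : T ∈ 𝒯) : ψ '' T ∈ 𝒯 :=
  h.map ψ hψ.adj T hT

theorem NestedCuts.false_of_swap (hD : IsDigraph E) (hhom : DigraphCHom E)
    (h : NestedCuts (UG E) 𝒯) {T : Set V} (hT : T ∈ 𝒯) {s a b c d : V} (hd : Big (UG E) T d)
    (hb : b ∈ T) (hc : ConnOff (UG E) T d c) (ha : a ∉ T) (hda : ¬ ConnOff (UG E) T d a)
    (hab : ¬ (UG E).Adj a b) (hac : ¬ (UG E).Adj a c) (hbc : ¬ (UG E).Adj b c)
    (hsa : (UG E).Adj s a) (hsb : (UG E).Adj s b) (hsc : (UG E).Adj s c)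
    (hdir : E s a ↔ E s b) : False := by
  have hdir' : E a s ↔ E b s := by
    rw [UG_adj_iff hD] at hsa hsb
    have := hD.2 s a
    have := hD.2 s b
    tauto
  have nac : a ≠ c := by rintro rfl; exact hda hc
  have nbc : b ≠ c := by rintro rfl; exact hc.right hb
  have nab : a ≠ b := by rintro rfl; exact ha hb
  have hab' := hab
  have hac' := hac
  have hbc' := hbc
  simp only [UG_adj_iff hD, not_or] at hab' hac' hbc'
  obtain ⟨σ, hσ, hfix, e1, e2⟩ := hhom.move_two hD.1 (M := {s, c}) (by simp) (x₁ := a) (y₁ := b)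
    (x₂ := b) (y₂ := a) (by simp [hsa.ne', nac]) (by simp [hsb.ne', nbc])
    (by simp [hsb.ne', nbc]) (by simp [hsa.ne', nac])
    (by simp [hdir, hdir', hac'.1, hac'.2, hbc'.1, hbc'.2])
    (by simp [hdir, hdir', hac'.1, hac'.2, hbc'.1, hbc'.2]) nab nab.symm
    (by simp [hab'.1, hab'.2]) (by simp [hab'.1, hab'.2])
    (by
      refine (ConnSet.singleton s).attach (by simp) ?_
      rintro x (rfl | rfl | rfl | rfl)
      · exact Or.inr (Or.inl ⟨s, rfl, hsb⟩)
      · exact Or.inr (Or.inl ⟨s, rfl, hsa⟩)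
      · exact Or.inl rfl
      · exact Or.inr (Or.inl ⟨s, rfl, hsc⟩))
  have e3 : σ c = c := hfix c (by simp)
  have hT' := h.map_aut hσ hT
  have haT' : a ∈ σ '' T := ⟨b, hb, e2⟩
  have hbT' : b ∉ σ '' T := by
    rintro ⟨x, hx, hxb⟩
    rw [← e1] at hxb
    exact ha (σ.injective hxb ▸ hx)
  have hn : ¬ ConnOff (UG E) (σ '' T) b c := by
    rw [← e1, ← e3]
    rw [ConnOff.map_iff σ hσ.adj]
    exact fun hc' => hda (hc.trans hc'.symm)
  obtain ⟨e, hbe, hde⟩ := (h.cut T hT).full hd hb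
  have h1 : ConnOff (UG E) (σ '' T) e c := (hde.symm.trans hc).change fun x hx hxT' =>
    hda ((hde.trans hx).trans (h.nested T hT _ hT' x hxT' a haT' hx.right ha))
  exact hn ((ConnOff.of_adj hbe hbT' h1.1).trans h1)

theorem NestedCuts.exists_next (h : NestedCuts (UG E) 𝒯)
    (hadj : ∀ x y, (UG E).Adj x y → ∃ T ∈ 𝒯, x ∈ T ∧ y ∈ T) {s : V} (A : CutAt (UG E) 𝒯 s) :
    ∃ (B : CutAt (UG E) 𝒯 s) (y : V), (UG E).Adj s y ∧ ConnOff (UG E) A.cut A.pt y ∧ y ∈ B.cut ∧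
      (∀ z, ConnOff (UG E) B.cut B.pt z → ConnOff (UG E) A.cut A.pt z) ∧
      ∀ z ∈ B.cut, z ∈ A.cut ∨ ConnOff (UG E) A.cut A.pt z := by
  obtain ⟨T, hT, hs, d, hd⟩ := A
  obtain ⟨y, hsy, hdy⟩ := (h.cut T hT).full hd hs
  obtain ⟨T', hT', hsT', hyT'⟩ := hadj s y hsy
  have h1 : ∀ z ∈ T', z ∈ T ∨ ConnOff (UG E) T d z := fun z hz => by
    by_cases hzT : z ∈ T
    · exact Or.inl hzT
    · exact Or.inr (hdy.trans (h.nested T hT T' hT' y hyT' z hz hdy.right hzT))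
  obtain ⟨e, he, hde⟩ := (h.cut T hT).sep.exists_other d
  have h2 : ∀ z, ConnOff (UG E) T e z → z ∉ T' := fun z hz hzT' =>
    (h1 z hzT').elim hz.right fun h => hde (h.trans hz.symm)
  have h3 : ∀ z ∈ T, z ∉ T' → ConnOff (UG E) T' e z := fun z hz hzT' => by
    obtain ⟨a, hza, hea⟩ := (h.cut T hT).full he hz
    exact (hea.change h2).step hza.symm hzT'
  obtain ⟨d', hd', hed'⟩ := (h.cut T' hT').sep.exists_other e
  have h4 : ∀ z, ConnOff (UG E) T' d' z → z ∉ T := fun z hz hzT =>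
    hed' ((h3 z hzT hz.right).trans hz.symm)
  obtain ⟨a, hya, hda⟩ := (h.cut T' hT').full hd' hyT'
  refine ⟨⟨T', hT', hsT', d', hd'⟩, y, hsy, hdy, hyT', fun z hz => ?_, h1⟩
  exact (hdy.step hya (h4 a hda)).trans ((hda.symm.trans hz).change fun w hw => h4 w (hda.trans hw))

theorem NestedCuts.not_adj_mem (hD : IsDigraph E) (hhom : DigraphCHom E)
    (h : NestedCuts (UG E) 𝒯) : ∀ T ∈ 𝒯, ∀ x ∈ T, ∀ y ∈ T, ¬ (UG E).Adj x y := by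
  intro T₀ hT₀ s hs t ht hst
  have hadj : ∀ x y, (UG E).Adj x y → ∃ T ∈ 𝒯, x ∈ T ∧ y ∈ T := by
    have key : ∀ x y x' y' : V, E x y → E x' y' → (∃ T ∈ 𝒯, x ∈ T ∧ y ∈ T) →
        ∃ T ∈ 𝒯, x' ∈ T ∧ y' ∈ T := by
      rintro x y x' y' hxy hxy' ⟨T, hT, hx, hy⟩
      obtain ⟨ψ, hψ, rfl, rfl⟩ := hhom.edge_transitive hD hxy hxy'
      exact ⟨_, h.map_aut hψ hT, mem_image_of_mem ψ hx, mem_image_of_mem ψ hy⟩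
    have key2 : ∀ x y, E x y → ∃ T ∈ 𝒯, x ∈ T ∧ y ∈ T := by
      intro x y hxy
      rcases (UG_adj_iff hD).1 hst with hst | hst
      · exact key _ _ _ _ hst hxy ⟨T₀, hT₀, hs, ht⟩
      · exact key _ _ _ _ hst hxy ⟨T₀, hT₀, ht, hs⟩
    intro x y hxy
    rcases (UG_adj_iff hD).1 hxy with hxy | hxy
    · exact key2 x y hxy
    · obtain ⟨T, hT, h1, h2⟩ := key2 y x hxy
      exact ⟨T, hT, h2, h1⟩
  choose next y hy using fun A : CutAt (UG E) 𝒯 s => h.exists_next hadj A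
  obtain ⟨d₀, hd₀, -⟩ := (h.cut T₀ hT₀).sep.exists_other s
  let A : ℕ → CutAt (UG E) 𝒯 s := fun n => next^[n] ⟨T₀, hT₀, hs, d₀, hd₀⟩
  have hA : ∀ n, A (n + 1) = next (A n) := fun n => Function.iterate_succ_apply' _ _ _
  have hsub : ∀ i j, i ≤ j → (∀ z, ConnOff (UG E) (A j).cut (A j).pt z →
      ConnOff (UG E) (A i).cut (A i).pt z) ∧
      ∀ z ∈ (A j).cut, z ∈ (A i).cut ∨ ConnOff (UG E) (A i).cut (A i).pt z := by
    intro i j hij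
    induction j, hij using Nat.le_induction with
    | base => exact ⟨fun z hz => hz, fun z hz => Or.inl hz⟩
    | succ j _ ih =>
      rw [hA]
      obtain ⟨-, -, -, h1, h2⟩ := hy (A j)
      exact ⟨fun z hz => ih.1 z (h1 z hz), fun z hz => (h2 z hz).elim (ih.2 z)
        fun h => Or.inr (ih.1 z h)⟩
  have hadjy : ∀ i, (UG E).Adj s (y (A i)) := fun i => (hy (A i)).1
  have hymem : ∀ i, y (A i) ∈ (A (i + 1)).cut := fun i => by rw [hA]; exact (hy (A i)).2.2.1
  have hyin : ∀ i j, i ≤ j → ConnOff (UG E) (A i).cut (A i).pt (y (A j)) := fun i j hij =>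
    (hsub i j hij).1 _ (hy (A j)).2.1
  have hyout : ∀ i j, i < j → ¬ ConnOff (UG E) (A j).cut (A j).pt (y (A i)) := fun i j hij hc =>
    ((hsub (i + 1) j hij).1 _ hc).right (hymem i)
  have hgone : ∀ i m j, i < m → m ≤ j → y (A i) ∉ (A m).cut → y (A i) ∉ (A j).cut :=
    fun i m j him hmj hm hj => ((hsub m j hmj).2 _ hj).elim hm (hyout i m him)
  have hinj : Function.Injective fun i => y (A i) := by
    have hlt : ∀ i j, i < j → y (A i) ≠ y (A j) := fun i j hij heq => by
      refine hyout i (i + 1) (by omega) ?_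
      rw [heq]
      exact hyin (i + 1) j hij
    intro i j hij
    rcases lt_trichotomy i j with hl | hl | hl
    · exact absurd hij (hlt i j hl)
    · exact hl
    · exact absurd hij.symm (hlt j i hl)
  have hperm : {i | ∀ m, i < m → y (A i) ∈ (A m).cut}.Finite := by
    by_contra hinf
    obtain ⟨F, hF, hFc⟩ := Set.Infinite.exists_subset_card_eq hinf (T₀.ncard + 1)
    obtain ⟨M, hM⟩ := F.bddAbove
    have h1 : (fun i => y (A i)) '' (F : Set ℕ) ⊆ (A (M + 1)).cut := by
      rintro _ ⟨i, hi, rfl⟩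
      exact hF hi _ (Nat.lt_succ_of_le (hM hi))
    have h2 := ncard_le_ncard h1 (h.cut _ (A (M + 1)).mem).fin
    rw [ncard_image_of_injective _ hinj, ncard_coe_finset, hFc,
      (h.cut _ (A (M + 1)).mem).ncard_eq (h.cut T₀ hT₀)] at h2
    omega
  obtain ⟨W, hW, hWt, hWd⟩ : ∃ W : Set ℕ, W.Infinite ∧
      (∀ i ∈ W, ∃ m, i < m ∧ y (A i) ∉ (A m).cut) ∧
      ∀ i ∈ W, ∀ j ∈ W, (E s (y (A i)) ↔ E s (y (A j))) := by
    have h1 := hperm.infinite_compl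
    rw [← inter_union_compl {i | ∀ m, i < m → y (A i) ∈ (A m).cut}ᶜ {i | E s (y (A i))},
      infinite_union] at h1
    have h2 : ∀ i ∈ {i | ∀ m, i < m → y (A i) ∈ (A m).cut}ᶜ, ∃ m, i < m ∧ y (A i) ∉ (A m).cut := by
      intro i hi
      simpa using hi
    rcases h1 with h1 | h1
    · exact ⟨_, h1, fun i hi => h2 i hi.1, fun i hi j hj => iff_of_true hi.2 hj.2⟩
    · exact ⟨_, h1, fun i hi => h2 i hi.1, fun i hi j hj => iff_of_false hi.2 hj.2⟩
  obtain ⟨a, ha⟩ := hW.nonempty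
  obtain ⟨m, ham, hm⟩ := hWt a ha
  obtain ⟨b, hb, hmb⟩ := hW.exists_gt m
  obtain ⟨m', hbm, hm'⟩ := hWt b hb
  obtain ⟨c, hc, hmc⟩ := hW.exists_gt m'
  have hnadj : ∀ i j m, i < m → m ≤ j → y (A i) ∉ (A m).cut → ¬ (UG E).Adj (y (A i)) (y (A j)) :=
    fun i j m him hmj hm hadj => hyout i m him ((hyin m j hmj).step hadj.symm hm)
  exact h.false_of_swap hD hhom (A (b + 1)).mem (A (b + 1)).big (hymem b)
    (hyin (b + 1) c (by omega)) (hgone a m _ ham (by omega) hm) (hyout a _ (by omega))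
    (hnadj a b m ham hmb.le hm) (hnadj a c m ham (by omega) hm) (hnadj b c m' hbm hmc.le hm')
    (hadjy a) (hadjy b) (hadjy c) (hWd a ha b hb)

theorem NestedCuts.exists_mem (hhom : DigraphCHom E) (hD : IsDigraph E)
    (hconn : (UG E).Connected) (h : NestedCuts (UG E) 𝒯) (s : V) : ∃ T ∈ 𝒯, s ∈ T := by
  obtain ⟨T, hT⟩ := h.nonempty
  obtain ⟨u, v, -, -, hn⟩ := (h.cut T hT).sep
  have : T.Nonempty := by
    rw [nonempty_iff_ne_empty]
    rintro rfl
    exact hn (ConnOff.of_preconnected hconn u v)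
  obtain ⟨t, ht⟩ := this
  obtain ⟨ψ, hψ, rfl⟩ := hhom.vertex_transitive hD.1 t s
  exact ⟨_, h.map_aut hψ hT, mem_image_of_mem ψ ht⟩

theorem NestedCuts.exists_sep_nbrs (hD : IsDigraph E) (hhom : DigraphCHom E)
    (hconn : (UG E).Connected) (htri : HasTriangle E) (h : NestedCuts (UG E) 𝒯) {s y z : V}
    (hy : (UG E).Adj s y) (hz : (UG E).Adj s z) (hne : y ≠ z) (hyz : ¬ (UG E).Adj y z) :
    ∃ T ∈ 𝒯, s ∈ T ∧ y ∉ T ∧ z ∉ T ∧ ¬ ConnOff (UG E) T y z := by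
  obtain ⟨T, hT, hs⟩ := h.exists_mem hhom hD hconn s
  have hno := h.not_adj_mem hD hhom T hT s hs
  obtain ⟨d, d', hd, hd', hn⟩ := (h.cut T hT).sep
  have key : ∀ d, Big (UG E) T d → ∀ y, (UG E).Adj s y → ∃ a, ConnOff (UG E) T d a ∧
      (UG E).Adj s a ∧ (E s a ↔ E s y) ∧ (E a s ↔ E y s) := by
    intro d hd y hy
    obtain ⟨a, hsa, hda⟩ := (h.cut T hT).full hd hs
    have key2 : ∃ b c, ConnOff (UG E) T d b ∧ ConnOff (UG E) T d c ∧ E s b ∧ E c s := by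
      rcases (UG_adj_iff hD).1 hsa with h1 | h1
      · obtain ⟨b, hb, hab⟩ := htri.exists_in hD hhom h1
        have hsb : (UG E).Adj s b := (UG_adj_iff hD).2 (Or.inr hb)
        exact ⟨a, b, hda, hda.step hab.symm fun hbT => hno b hbT hsb, h1, hb⟩
      · obtain ⟨b, hb, hab⟩ := htri.exists_out hD hhom h1
        have hsb : (UG E).Adj s b := (UG_adj_iff hD).2 (Or.inl hb)
        exact ⟨b, a, hda.step hab fun hbT => hno b hbT hsb, hda, hb, h1⟩
    obtain ⟨b, c, hb, hc, h1, h2⟩ := key2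
    rcases (UG_adj_iff hD).1 hy with h3 | h3
    · exact ⟨b, hb, (UG_adj_iff hD).2 (Or.inl h1), iff_of_true h1 h3,
        iff_of_false (hD.2 _ _ h1) (hD.2 _ _ h3)⟩
    · exact ⟨c, hc, (UG_adj_iff hD).2 (Or.inr h2), iff_of_false (hD.2 _ _ h2) (hD.2 _ _ h3),
        iff_of_true h2 h3⟩
  obtain ⟨a, hda, hsa, a1, a2⟩ := key d hd y hy
  obtain ⟨b, hdb, hsb, b1, b2⟩ := key d' hd' z hz
  have hab : ¬ ConnOff (UG E) T a b := fun hab => hn ((hda.trans hab).trans hdb.symm)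
  have hnab : ¬ (UG E).Adj a b := fun hh => hab (.of_adj hh hda.right hdb.right)
  have nab : a ≠ b := by rintro rfl; exact hab (.refl hda.right)
  simp only [UG_adj_iff hD, not_or] at hnab hyz
  obtain ⟨ψ, hψ, hfix, rfl, rfl⟩ := hhom.move_two hD.1 (M := {s}) (by simp) (x₁ := a) (y₁ := y)
    (x₂ := b) (y₂ := z) (by simp [hsa.ne']) (by simp [hy.ne']) (by simp [hsb.ne'])
    (by simp [hz.ne']) (by simp [a1, a2]) (by simp [b1, b2]) nab hne (by simp [hnab.1, hyz.1])
    (by simp [hnab.2, hyz.2]) (by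
      refine (ConnSet.singleton s).attach (by simp) ?_
      rintro x (rfl | rfl | rfl)
      · exact Or.inr (Or.inl ⟨s, rfl, hsb⟩)
      · exact Or.inr (Or.inl ⟨s, rfl, hsa⟩)
      · exact Or.inl rfl)
  have hmem : ∀ x, x ∉ T → ψ x ∉ ψ '' T := by
    rintro x hx ⟨y, hy, hxy⟩
    exact hx (ψ.injective hxy ▸ hy)
  refine ⟨ψ '' T, h.map_aut hψ hT, ⟨s, hs, hfix s rfl⟩, hmem _ hda.right, hmem _ hdb.right, ?_⟩
  rwa [ConnOff.map_iff ψ hψ.adj]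

theorem ConnOff.of_walk {G : SimpleGraph V} {S : Set V} {u v : V} (w : G.Walk u v)
    (h : ∀ x ∈ w.support, x ∉ S) : ConnOff G S u v := by
  induction w with
  | nil => exact .refl (h _ (by simp))
  | cons hadj w ih =>
    have h1 := ih fun x hx => h x (by simp [hx])
    exact (ConnOff.of_adj hadj (h _ (by simp)) h1.1).trans h1

theorem SimpleGraph.Connected.exists_adj_dist {G : SimpleGraph V} (hG : G.Connected) {u v : V}
    {n : ℕ} (h : G.dist u v = n + 1) : ∃ p, G.Adj u p ∧ G.dist p v = n := by
  obtain ⟨w, hw⟩ := hG.exists_walk_length_eq_dist u v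
  cases w with
  | nil => simp at h
  | cons hadj w =>
    rename_i p
    refine ⟨p, hadj, ?_⟩
    simp only [SimpleGraph.Walk.length_cons] at hw
    have h1 := SimpleGraph.dist_le w
    have h2 := hG.dist_triangle (u := u) (v := p) (w := v)
    rw [SimpleGraph.dist_eq_one_iff_adj.2 hadj] at h2
    omega

theorem NestedCuts.subsingleton (hD : IsDigraph E) (hhom : DigraphCHom E)
    (hconn : (UG E).Connected) (htri : HasTriangle E) (h : NestedCuts (UG E) 𝒯) (n : ℕ) :
    ∀ u v T, T ∈ 𝒯 → u ∈ T → v ∈ T → (UG E).dist u v = n → u = v := by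
  induction n using Nat.strong_induction_on with
  | _ n ih =>
    intro u v T hT hu hv hn
    by_contra hne
    rcases n with _ | _ | n
    · exact hne (hconn.dist_eq_zero_iff.1 hn)
    · exact h.not_adj_mem hD hhom T hT u hu v hv (SimpleGraph.dist_eq_one_iff_adj.1 hn)
    obtain ⟨p, hup, hp⟩ := hconn.exists_adj_dist hn
    obtain ⟨q, hpq, hq⟩ := hconn.exists_adj_dist hp
    have huq : u ≠ q := by rintro rfl; omega
    have huq' : ¬ (UG E).Adj u q := fun hadj => by
      have := hconn.dist_triangle (u := u) (v := q) (w := v)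
      rw [SimpleGraph.dist_eq_one_iff_adj.2 hadj] at this
      omega
    obtain ⟨T', hT', hpT', huT', hqT', hsep⟩ :=
      h.exists_sep_nbrs hD hhom hconn htri hup.symm hpq huq huq'
    have hvT' : v ∉ T' := fun hvT' => by
      have := ih (n + 1) (by omega) p v T' hT' hpT' hvT' hp
      subst this
      simp at hp
    obtain ⟨w, hw⟩ := hconn.exists_walk_length_eq_dist q v
    refine hsep ((h.nested T' hT' T hT u hu v hv huT' hvT').trans (ConnOff.of_walk w ?_).symm)
    intro x hx hxT'
    classical
    have e1 := SimpleGraph.dist_le (w.takeUntil x hx)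
    have e2 := SimpleGraph.dist_le (w.dropUntil x hx)
    have e3 := w.length_takeUntil_le_length hx
    have e4 := w.length_dropUntil_le_length hx
    have e5 := hconn.dist_triangle (u := p) (v := q) (w := x)
    rw [SimpleGraph.dist_eq_one_iff_adj.2 hpq] at e5
    have := ih _ (by omega) p x T' hT' hpT' hxT' rfl
    subst this
    omega

/-- Distinct nonadjacent neighbours of a vertex are separated by that vertex. -/
theorem not_connOff_nbrs (hD : IsDigraph E) (hhom : DigraphCHom E) (hconn : (UG E).Connected)
    (htri : HasTriangle E) (hends : MoreThanOneEnd (UG E)) {s y z : V} (hy : (UG E).Adj s y)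
    (hz : (UG E).Adj s z) (hne : y ≠ z) (hyz : ¬ (UG E).Adj y z) : ¬ ConnOff (UG E) {s} y z := by
  obtain ⟨𝒯, h⟩ := exists_nestedCuts hends
  obtain ⟨T, hT, hs, -, -, hn⟩ := h.exists_sep_nbrs hD hhom hconn htri hy hz hne hyz
  have : T = {s} := by
    ext x
    exact ⟨fun hx => h.subsingleton hD hhom hconn htri _ x s T hT hx hs rfl, by rintro rfl; exact hs⟩
  rwa [this] at hn

end Triangles

section Extension

variable {V : Type u} {G : SimpleGraph V}

/-- Swapping two disjoint vertex sets along an automorphism. -/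
theorem exists_swap_aut {W W' : Set V} (hd : Disjoint W W') (g : Equiv.Perm V)
    (hg : ∀ x y, G.Adj (g x) (g y) ↔ G.Adj x y) (hW : ∀ w, g w ∈ W' ↔ w ∈ W)
    (hout : ∀ w ∈ W, ∀ u, u ∉ W → u ∉ W' → (G.Adj w u ↔ G.Adj (g w) u))
    (hcross : ∀ w ∈ W, ∀ w' ∈ W', G.Adj w w' → G.Adj (g w) (g.symm w')) :
    ∃ h : Equiv.Perm V, (∀ x y, G.Adj (h x) (h y) ↔ G.Adj x y) ∧ (∀ w ∈ W, h w = g w) ∧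
      ∀ u, u ∉ W → u ∉ W' → h u = u := by
  classical
  let f : V → V := fun x => if x ∈ W then g x else if x ∈ W' then g.symm x else x
  have f1 : ∀ x ∈ W, f x = g x := fun x hx => if_pos hx
  have hd' : ∀ x ∈ W', x ∉ W := fun x hx hx' => disjoint_left.1 hd hx' hx
  have f2 : ∀ x ∈ W', f x = g.symm x := fun x hx => by
    simp only [f, if_neg (hd' x hx), if_pos hx]
  have f3 : ∀ x, x ∉ W → x ∉ W' → f x = x := fun x hx hx' => by
    simp only [f, if_neg hx, if_neg hx']
  have hW' : ∀ w ∈ W', g.symm w ∈ W := fun w hw => by rw [← hW]; simpa using hw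
  have hf : Function.Involutive f := by
    intro x
    by_cases hx : x ∈ W
    · rw [f1 x hx, f2 _ ((hW x).2 hx)]; simp
    by_cases hx' : x ∈ W'
    · rw [f2 x hx', f1 _ (hW' x hx')]; simp
    rw [f3 x hx hx', f3 x hx hx']
  have hg' : ∀ x y, G.Adj (g.symm x) (g.symm y) ↔ G.Adj x y := fun x y => by
    rw [← hg]; simp
  have hout' : ∀ w ∈ W', ∀ u, u ∉ W → u ∉ W' → (G.Adj w u ↔ G.Adj (g.symm w) u) := by
    intro w hw u hu hu'
    rw [hout _ (hW' w hw) u hu hu']; simp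
  have key : ∀ x y, G.Adj x y → G.Adj (f x) (f y) := by
    intro x y hxy
    by_cases hx : x ∈ W
    · rw [f1 x hx]
      by_cases hy : y ∈ W
      · rw [f1 y hy]; exact (hg x y).2 hxy
      by_cases hy' : y ∈ W'
      · rw [f2 y hy']; exact hcross x hx y hy' hxy
      rw [f3 y hy hy']; exact (hout x hx y hy hy').1 hxy
    by_cases hx' : x ∈ W'
    · rw [f2 x hx']
      by_cases hy : y ∈ W
      · rw [f1 y hy]; exact (hcross y hy x hx' hxy.symm).symm
      by_cases hy' : y ∈ W'
      · rw [f2 y hy']; exact (hg' x y).2 hxy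
      rw [f3 y hy hy']; exact (hout' x hx' y hy hy').1 hxy
    rw [f3 x hx hx']
    by_cases hy : y ∈ W
    · rw [f1 y hy]; exact ((hout y hy x hx hx').1 hxy.symm).symm
    by_cases hy' : y ∈ W'
    · rw [f2 y hy']; exact ((hout' y hy' x hx hx').1 hxy.symm).symm
    rwa [f3 y hy hy']
  refine ⟨hf.toPerm f, fun x y => ⟨fun h => ?_, key x y⟩, f1, f3⟩
  have := key _ _ h
  simpa [hf x, hf y] using this

/-- Nonadjacent neighbours of a vertex are separated by it. -/
def BlockGraph (G : SimpleGraph V) : Prop :=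
  ∀ s y z, G.Adj s y → G.Adj s z → y ≠ z → ¬ G.Adj y z → ¬ ConnOff G {s} y z

theorem exists_swap_of_adj (hG : G.Connected) (hblock : BlockGraph G) {X : Set V}
    (hX : ConnSet G X) {x v v' : V} (hx : x ∈ X) (hv : v ∉ X) (hv' : v' ∉ X) (hxv : G.Adj x v)
    (hxv' : G.Adj x v') (hvv : G.Adj v v') (g : Equiv.Perm V)
    (hg : ∀ x y, G.Adj (g x) (g y) ↔ G.Adj x y) (hgv : g v = v')
    (hgx : g x = x ∨ G.Adj (g x) x) :
    ∃ h : Equiv.Perm V, (∀ x y, G.Adj (h x) (h y) ↔ G.Adj x y) ∧ (∀ y ∈ X, h y = y) ∧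
      h v = v' := by
  have key : ∀ {v v' : V}, G.Adj x v → G.Adj x v' → G.Adj v v' → ∀ w, ¬ ConnOff G {v} w x →
      ConnOff G {v'} w x := by
    intro v v' hxv hxv' hvv w hw
    by_cases hwv : w = v
    · subst hwv
      exact .of_adj hxv.symm (by simpa using hvv.ne) (by simpa using hxv'.ne)
    have h0 : ConnOff G ({v} \ {v}) w x := by
      rw [sdiff_self]; exact .of_preconnected hG w x
    obtain ⟨a, hva, hwa⟩ := exists_adj_of_connOff_diff (by simpa using hwv) h0 hw
    have h1 : ConnOff G {v'} w a := hwa.change fun y hy hyv => by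
      rw [mem_singleton_iff] at hyv
      subst hyv
      exact hw (hy.step hxv'.symm (by simpa using hxv.ne))
    exact (h1.step hva.symm (by simpa using hvv.ne)).step hxv.symm (by simpa using hxv'.ne)
  have edge : ∀ v w u, ¬ ConnOff G {v} w x → ConnOff G {v} u x → G.Adj w u → w = v := by
    intro v w u hw hu hwu
    by_contra hne
    exact hw ((ConnOff.of_adj hwu (by simpa using hne) hu.1).trans hu)
  have hnb : ∀ {v v' : V}, G.Adj x v → G.Adj x v' → G.Adj v v' → ∀ u, ConnOff G {v} u x →
      ConnOff G {v'} u x → G.Adj v u → G.Adj v' u := by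
    intro v v' hxv hxv' hvv u hu hu' hvu
    by_contra hne
    refine hblock v v' u hvv hvu ?_ hne (hu.step hxv' (by simpa using hvv.ne')).symm
    rintro rfl
    exact hu'.1 rfl
  have hgx' : ConnOff G {v'} (g x) x := by
    rcases hgx with hgx | hgx
    · rw [hgx]; exact .refl (by simpa using hxv'.ne)
    · refine .of_adj hgx ?_ (by simpa using hxv'.ne)
      rw [mem_singleton_iff, ← hgv, g.injective.eq_iff]
      exact hxv.ne
  have hmap : ∀ w, ConnOff G {v'} (g w) x ↔ ConnOff G {v} w x := fun w => by
    have := ConnOff.map_iff (S := {v}) g hg (u := w) (v := x)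
    rw [image_singleton, hgv] at this
    rw [← this]
    exact ⟨fun h => h.trans hgx'.symm, fun h => h.trans hgx'⟩
  obtain ⟨h, h1, h2, h3⟩ := exists_swap_aut (G := G) (W := {w | ¬ ConnOff G {v} w x})
    (W' := {w | ¬ ConnOff G {v'} w x})
    (disjoint_left.2 fun w hw hw' => hw' (key hxv hxv' hvv w hw)) g hg
    (fun w => not_congr (hmap w))
    (by
      intro w hw u hu hu'
      simp only [mem_ofPred_eq, not_not] at hw hu hu'
      constructor
      · intro hwu
        obtain rfl := edge v w u hw hu hwu
        rw [hgv]
        exact hnb hxv hxv' hvv u hu hu' hwu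
      · intro hwu
        have e := edge v' (g w) u ((not_congr (hmap w)).2 hw) hu' hwu
        rw [e] at hwu
        rw [← hgv, g.injective.eq_iff] at e
        subst e
        exact hnb hxv' hxv hvv.symm u hu' hu hwu)
    (by
      intro w hw w' hw' hww
      simp only [mem_ofPred_eq] at hw hw'
      have e1 := edge v w w' hw (by
        by_contra hc
        exact hw' (key hxv hxv' hvv w' hc)) hww
      have e2 := edge v' w' w hw' (key hxv hxv' hvv w hw) hww.symm
      subst e1 e2
      rw [hgv, ← hgv, Equiv.symm_apply_apply, hgv]
      exact hvv.symm)
  have hfix : ∀ v, v ∉ X → ∀ y ∈ X, ConnOff G {v} y x := fun v hv y hy =>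
    .of_connSet hX (by simpa using hv) hy hx
  refine ⟨h, h1, fun y hy => h3 y (not_not.2 (hfix v hv y hy)) (not_not.2 (hfix v' hv' y hy)), ?_⟩
  rw [h2 v fun hc => hc.1 rfl, hgv]

theorem exists_swap_of_not_adj (hblock : BlockGraph G) {X : Set V}
    (hX : ConnSet G X) {x v v' : V} (hx : x ∈ X) (hv : v ∉ X) (hv' : v' ∉ X) (hxv : G.Adj x v)
    (hxv' : G.Adj x v') (hne : v ≠ v') (hvv : ¬ G.Adj v v')
    (hnbr : ∀ y ∈ X, (G.Adj y v ↔ G.Adj y v')) (g : Equiv.Perm V)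
    (hg : ∀ x y, G.Adj (g x) (g y) ↔ G.Adj x y) (hgx : g x = x)
    (hgv : g v = v' ∨ G.Adj (g v) v') :
    ∃ h : Equiv.Perm V, (∀ x y, G.Adj (h x) (h y) ↔ G.Adj x y) ∧ (∀ y ∈ X, h y = y) ∧
      h v = g v := by
  have hsep := hblock x v v' hxv hxv' hne hvv
  have hgv' : ConnOff G {x} (g v) v' := by
    rcases hgv with hgv | hgv
    · rw [hgv]; exact .refl (by simpa using hxv'.ne')
    · refine .of_adj hgv ?_ (by simpa using hxv'.ne')
      rw [mem_singleton_iff]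
      intro hc
      rw [← hgx, g.injective.eq_iff] at hc
      exact hxv.ne' hc
  have hmap : ∀ w, ConnOff G {x} v' (g w) ↔ ConnOff G {x} v w := fun w => by
    have := ConnOff.map_iff (S := {x}) g hg (u := v) (v := w)
    rw [image_singleton, hgx] at this
    rw [← this]
    exact ⟨fun h => hgv'.trans h, fun h => hgv'.symm.trans h⟩
  have edge : ∀ v w u, ConnOff G {x} v w → ¬ ConnOff G {x} v u → G.Adj w u → u = x := by
    intro v w u hw hu hwu
    by_contra hux
    exact hu (hw.step hwu (by simpa using hux))
  have avoid : ∀ v v', G.Adj x v → G.Adj x v' → ¬ ConnOff G {x} v v' → v ∉ X →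
      (∀ y ∈ X, (G.Adj y v ↔ G.Adj y v')) → ∀ y ∈ X, ¬ ConnOff G {x} v y := by
    intro v v' hxv hxv' hsep hv hnbr y hy
    have hr := hX.reach hx hy
    have : y ∈ X ∧ ¬ ConnOff G {x} v y := by
      refine hr.induction_mem (P := fun y => y ∈ X ∧ ¬ ConnOff G {x} v y)
        ⟨hx, fun hc => hc.right rfl⟩ ?_
      rintro a b ⟨-, ha⟩ hab hb
      refine ⟨hb, fun hvb => ?_⟩
      obtain rfl := edge v b a hvb ha hab.symm
      have hbv : G.Adj b v := by
        by_contra hc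
        exact hblock a b v hab hxv (by rintro rfl; exact hv hb) hc hvb.symm
      exact hsep (hvb.step ((hnbr b hb).1 hbv) (by simpa using hxv'.ne'))
    exact this.2
  obtain ⟨h, h1, h2, h3⟩ := exists_swap_aut (G := G) (W := {w | ConnOff G {x} v w})
    (W' := {w | ConnOff G {x} v' w})
    (disjoint_left.2 fun w hw hw' => hsep (ConnOff.trans hw (ConnOff.symm hw'))) g hg hmap
    (by
      intro w hw u hu hu'
      constructor
      · intro hwu
        obtain rfl := edge v w u hw hu hwu
        have := (hg w u).2 hwu
        rwa [hgx] at this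
      · intro hwu
        obtain rfl := edge v' (g w) u ((hmap w).2 hw) hu' hwu
        rwa [← hg, hgx])
    (by
      intro w hw w' hw' hww
      exact absurd ((ConnOff.step hw hww (ConnOff.right hw')).trans (ConnOff.symm hw')) hsep)
  refine ⟨h, h1, fun y hy => h3 y (avoid v v' hxv hxv' hsep hv hnbr y hy)
    (avoid v' v hxv' hxv (fun hc => hsep hc.symm) hv' (fun y hy => (hnbr y hy).symm) y hy), ?_⟩
  exact h2 v (ConnOff.refl (by simpa using hxv.ne'))

end Extension

section GraphHom

variable {V : Type u} {E : V → V → Prop}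

theorem exists_aut_fix_base (hD : IsDigraph E) (hhom : DigraphCHom E) (htri : HasTriangle E)
    {x v v' : V} (hxv : (UG E).Adj x v) (hxv' : (UG E).Adj x v') :
    ∃ g : Equiv.Perm V, IsAut E g ∧ g x = x ∧ (g v = v' ∨ (UG E).Adj (g v) v') := by
  rcases (UG_adj_iff hD).1 hxv with h | h <;> rcases (UG_adj_iff hD).1 hxv' with h' | h'
  · obtain ⟨g, hg, e1, e2⟩ := hhom.edge_transitive hD h h'
    exact ⟨g, hg, e1, Or.inl e2⟩
  · obtain ⟨b, hb, hab⟩ := htri.exists_out hD hhom h'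
    obtain ⟨g, hg, e1, e2⟩ := hhom.edge_transitive hD h hb
    exact ⟨g, hg, e1, Or.inr (e2 ▸ hab.symm)⟩
  · obtain ⟨b, hb, hab⟩ := htri.exists_in hD hhom h'
    obtain ⟨g, hg, e1, e2⟩ := hhom.edge_transitive hD h hb
    exact ⟨g, hg, e2, Or.inr (e1 ▸ hab)⟩
  · obtain ⟨g, hg, e1, e2⟩ := hhom.edge_transitive hD h h'
    exact ⟨g, hg, e2, Or.inl e1⟩

theorem exists_aut_move_base (hD : IsDigraph E) (hhom : DigraphCHom E) (htri : HasTriangle E)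
    {x v v' : V} (hxv : (UG E).Adj x v) (hxv' : (UG E).Adj x v') :
    ∃ g : Equiv.Perm V, IsAut E g ∧ g v = v' ∧ (g x = x ∨ (UG E).Adj (g x) x) := by
  rcases (UG_adj_iff hD).1 hxv with h | h <;> rcases (UG_adj_iff hD).1 hxv' with h' | h'
  · obtain ⟨g, hg, e1, e2⟩ := hhom.edge_transitive hD h h'
    exact ⟨g, hg, e2, Or.inl e1⟩
  · obtain ⟨b, hb, hab⟩ := htri.exists_in hD hhom h'
    obtain ⟨g, hg, e1, e2⟩ := hhom.edge_transitive hD h hb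
    exact ⟨g, hg, e2, Or.inr (e1 ▸ hab)⟩
  · obtain ⟨b, hb, hab⟩ := htri.exists_out hD hhom h'
    obtain ⟨g, hg, e1, e2⟩ := hhom.edge_transitive hD h hb
    exact ⟨g, hg, e1, Or.inr (e2 ▸ hab.symm)⟩
  · obtain ⟨g, hg, e1, e2⟩ := hhom.edge_transitive hD h h'
    exact ⟨g, hg, e1, Or.inl e2⟩

theorem exists_aut_move_one (hD : IsDigraph E) (hhom : DigraphCHom E)
    (hconn : (UG E).Connected) (htri : HasTriangle E) (hblock : BlockGraph (UG E)) {X : Set V}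
    (hX : ConnSet (UG E) X) {x v v' : V} (hx : x ∈ X) (hv : v ∉ X) (hv' : v' ∉ X)
    (hxv : (UG E).Adj x v) (hnbr : ∀ y ∈ X, ((UG E).Adj y v ↔ (UG E).Adj y v')) :
    ∃ h : Equiv.Perm V, (∀ x y, (UG E).Adj (h x) (h y) ↔ (UG E).Adj x y) ∧
      (∀ y ∈ X, h y = y) ∧ h v = v' := by
  have adj_case : ∀ {v : V}, v ∉ X → (UG E).Adj x v → (UG E).Adj v v' →
      ∃ h : Equiv.Perm V, (∀ x y, (UG E).Adj (h x) (h y) ↔ (UG E).Adj x y) ∧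
      (∀ y ∈ X, h y = y) ∧ h v = v' := by
    intro v hv hxv hvv
    have hxv' := (hnbr x hx).1 ‹_›
    obtain ⟨g, hg, e1, e2⟩ := exists_aut_move_base hD hhom htri hxv hxv'
    exact exists_swap_of_adj hconn hblock hX hx hv hv' hxv hxv' hvv g hg.adj e1 e2
  have hxv' := (hnbr x hx).1 hxv
  by_cases hne : v = v'
  · exact ⟨Equiv.refl V, fun _ _ => Iff.rfl, fun _ _ => rfl, hne⟩
  by_cases hvv : (UG E).Adj v v'
  · exact adj_case hv hxv hvv
  obtain ⟨g, hg, e1, e2⟩ := exists_aut_fix_base hD hhom htri hxv hxv'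
  obtain ⟨h, h1, h2, h3⟩ :=
    exists_swap_of_not_adj hblock hX hx hv hv' hxv hxv' hne hvv hnbr g hg.adj e1 e2
  rw [← h3] at e2
  rcases e2 with e2 | e2
  · exact ⟨h, h1, h2, e2⟩
  · have hvX : h v ∉ X := fun hc => hv (h.injective (h2 _ hc) ▸ hc)
    have hxhv : (UG E).Adj x (h v) := by
      rw [← h2 x hx]; exact (h1 _ _).2 hxv
    obtain ⟨k, k1, k2, k3⟩ := adj_case hvX hxhv e2
    exact ⟨h.trans k, fun x y => (k1 _ _).trans (h1 _ _),
      fun y hy => by rw [Equiv.trans_apply, h2 y hy, k2 y hy], k3⟩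

theorem graphCHom_of_hasTriangle (hD : IsDigraph E) (hhom : DigraphCHom E)
    (hconn : (UG E).Connected) (htri : HasTriangle E) (hends : MoreThanOneEnd (UG E)) :
    GraphCHom (UG E) := by
  have hblock : BlockGraph (UG E) := fun s y z hy hz hne hyz =>
    not_connOff_nbrs hD hhom hconn htri hends hy hz hne hyz
  intro X Y hX hY hXc φ hφ
  have hXc := ConnSet.of_induce hXc
  obtain ⟨M, hM⟩ := (hX.finite_subsets.subset (t := {M | M ⊆ X ∧ ConnSet (UG E) M ∧
    ∃ ψ : Equiv.Perm V, (∀ x y, (UG E).Adj (ψ x) (ψ y) ↔ (UG E).Adj x y) ∧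
      ∀ a : X, a.1 ∈ M → ψ a = φ a}) (fun M hM => hM.1)).exists_maximal (by
        obtain ⟨o, ho⟩ := hXc.nonempty
        obtain ⟨ψ, hψ, e⟩ := hhom.vertex_transitive hD.1 o (φ ⟨o, ho⟩)
        refine ⟨{o}, singleton_subset_iff.2 ho, .singleton o, ψ, hψ.adj, ?_⟩
        rintro ⟨a, ha⟩ (rfl : a = o)
        exact e)
  obtain ⟨⟨hMX, hMc, ψ, hψ, hψφ⟩, hmax⟩ := hM
  have hMX' : ∀ x ∈ X, x ∈ M := by
    by_contra! hne
    obtain ⟨x, hx, hxM⟩ := hne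
    obtain ⟨m, hm⟩ := hMc.nonempty
    have : ∃ m ∈ M, ∃ v ∈ X, v ∉ M ∧ (UG E).Adj m v := by
      by_contra! hno
      exact hxM ((hXc.reach (hMX hm) hx).induction_mem (P := fun y => y ∈ M) hm
        fun a b ha hab hb => by
          by_contra hbM
          exact hno a ha b hb hbM hab)
    obtain ⟨m, hm, v, hv, hvM, hmv⟩ := this
    obtain ⟨h, h1, h2, h3⟩ := exists_aut_move_one hD hhom hconn htri hblock hMc hm hvM
      (v' := ψ.symm (φ ⟨v, hv⟩)) (fun hc => by
        have := hψφ ⟨_, hMX hc⟩ hc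
        simp only [Equiv.apply_symm_apply] at this
        have := φ.injective (Subtype.ext this)
        exact hvM (by rw [Subtype.mk.injEq] at this; rw [this]; exact hc)) hmv
      (fun y hy => by
        rw [← hψ y (ψ.symm _), Equiv.apply_symm_apply, hψφ ⟨y, hMX hy⟩ hy]
        exact hφ ⟨y, hMX hy⟩ ⟨v, hv⟩)
    refine hvM (hmax (y := insert v M) ⟨insert_subset hv hMX, hMc.insert_adj hm hmv, h.trans ψ,
      fun x y => (hψ _ _).trans (h1 _ _), ?_⟩ (subset_insert v M) (mem_insert v M))
    rintro ⟨a, ha⟩ (rfl | haM)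
    · simp [h3]
    · simp only [Equiv.trans_apply]
      rw [h2 a haM]
      exact hψφ ⟨a, ha⟩ haM
  exact ⟨⟨ψ, fun {x y} => hψ x y⟩, fun a => hψφ a (hMX' a a.2)⟩

end GraphHom

/-- Every connected C-homogeneous digraph of Type II with more than one end is
highly-arc-transitive. -/
theorem stmt_18 {V : Type u} (E : V → V → Prop) (hD : IsDigraph E)
    (hconn : (UG E).Connected) (hhom : DigraphCHom E)
    (htypeII : ¬ GraphCHom (UG E)) (hends : MoreThanOneEnd (UG E)) :
    HighlyArcTransitive E := by
  by_cases htri : HasTriangle E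
  · exact absurd (graphCHom_of_hasTriangle hD hhom hconn htri hends) htypeII
  · obtain ⟨S, hS, r, r', hr, hr', h1, h2, hn⟩ := hends.exists_separator
    have := hr.infinite
    exact highlyArcTransitive_of_not_hasTriangle hD hhom hconn htri
      ⟨S, hS, _, _, h1 0, h2 0, hn⟩
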